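/- arXiv:1302.2325 — 13 statements merged into one kernel-verified Lean document; each statement's English description precedes it below -/
import Mathlib

section
/- For a generic Conditional Gradient sequence (x_t) on X, one has f(x_t) − f_* ≤ 2L/(t+1) for every t ≥ 2. -/
open RealInnerProductSpace

/-- The gradient inequality for a convex function on a set, at a point of differentiability. -/
theorem ConvexOn.inner_gradient_le_sub
    {E : Type*} [NormedAddCommGroup E] [InnerProductSpace ℝ E] [CompleteSpace E]
    {s : Set E} {f : E → ℝ} (hf : ConvexOn ℝ s f) {x y g : E} (hx : x ∈ s) (hy : y ∈ s)
    (hg : HasGradientAt f g x) : ⟪g, y - x⟫ ≤ f y - f x := by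
  have hcomp := hf.comp_affineMap (AffineMap.lineMap x y : ℝ →ᵃ[ℝ] E)
  have hderiv : HasDerivAt (f ∘ (AffineMap.lineMap x y : ℝ →ᵃ[ℝ] E)) ⟪g, y - x⟫ 0 := by
    have hg' : HasFDerivAt f (InnerProductSpace.toDual ℝ E g)
        ((AffineMap.lineMap x y : ℝ →ᵃ[ℝ] E) 0) := by
      simpa using hg.hasFDerivAt
    simpa using hg'.comp_hasDerivAt (0 : ℝ) AffineMap.hasDerivAt_lineMap
  have h := hcomp.le_slope_of_hasDerivAt (x := 0) (y := 1) (by simpa using hx)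
    (by simpa using hy) one_pos hderiv
  simpa [slope_def_field] using h

/-- For a generic Conditional Gradient sequence `(x_t)` on `X`, one has
`f(x_t) − f_* ≤ 2L/(t+1)` for every `t ≥ 2`. -/
theorem cndg_rate
    {E : Type*} [NormedAddCommGroup E] [InnerProductSpace ℝ E] [FiniteDimensional ℝ E]
    (X : Set E) (hXne : X.Nonempty) (hXcpt : IsCompact X) (hXconv : Convex ℝ X)
    (nX : E → ℝ)
    (hn0 : ∀ v : E, nX v = 0 ↔ v = 0)
    (hnhom : ∀ (a : ℝ) (v : E), nX (a • v) = |a| * nX v)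
    (hntri : ∀ v w : E, nX (v + w) ≤ nX v + nX w)
    (hdiam : ∀ x ∈ X, ∀ y ∈ X, nX (y - x) ≤ 1)
    (f : E → ℝ) (f' : E → E) (L : ℝ) (hL : 0 < L)
    (hconv : ConvexOn ℝ X f)
    (hdiff : ∀ x ∈ X, HasGradientAt f (f' x) x)
    (hsmooth : ∀ x ∈ X, ∀ y ∈ X,
      f y ≤ f x + ⟪f' x, y - x⟫ + L / 2 * nX (y - x) ^ 2)
    (x xp : ℕ → E)
    (hx : ∀ t : ℕ, 1 ≤ t → x t ∈ X)
    (hxpX : ∀ t : ℕ, 1 ≤ t → xp t ∈ X)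
    (hxpmin : ∀ t : ℕ, 1 ≤ t → ∀ y ∈ X, ⟪f' (x t), xp t⟫ ≤ ⟪f' (x t), y⟫)
    (hrec : ∀ t : ℕ, 1 ≤ t →
      f (x (t + 1)) ≤ f (x t + ((2 : ℝ) / ((t : ℝ) + 1)) • (xp t - x t)))
    (xstar : E) (hxstarX : xstar ∈ X) (hmin : ∀ y ∈ X, f xstar ≤ f y) :
    ∀ t : ℕ, 2 ≤ t → f (x t) - f xstar ≤ 2 * L / ((t : ℝ) + 1) := by
  have hnonneg : ∀ v, 0 ≤ nX v := by
    intro v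
    have h1 := hntri v ((-1 : ℝ) • v)
    rw [hnhom, neg_one_smul, add_neg_cancel, (hn0 0).2 rfl] at h1
    norm_num at h1
    linarith
  have hstep : ∀ t : ℕ, 1 ≤ t → f (x (t + 1)) - f xstar ≤
      (1 - 2 / ((t : ℝ) + 1)) * (f (x t) - f xstar) + L / 2 * (2 / ((t : ℝ) + 1)) ^ 2 := by
    intro t ht
    have ht' : (1 : ℝ) ≤ t := by exact_mod_cast ht
    have hrec_t := hrec t ht
    set γ : ℝ := 2 / ((t : ℝ) + 1)
    have hγ0 : 0 ≤ γ := by positivity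
    have hγ1 : γ ≤ 1 := (div_le_one (by linarith)).2 (by linarith)
    have hmem : x t + γ • (xp t - x t) ∈ X :=
      hXconv.add_smul_sub_mem (hx t ht) (hxpX t ht) ⟨hγ0, hγ1⟩
    have hupper := hsmooth _ (hx t ht) _ hmem
    rw [add_sub_cancel_left, inner_smul_right, hnhom, abs_of_nonneg hγ0] at hupper
    have hlinear := hconv.inner_gradient_le_sub (hx t ht) hxstarX (hdiff _ (hx t ht))
    have hpmin := hxpmin t ht xstar hxstarX
    rw [inner_sub_right] at hupper hlinear
    have hnorm : (γ * nX (xp t - x t)) ^ 2 ≤ γ ^ 2 :=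
      pow_le_pow_left₀ (mul_nonneg hγ0 (hnonneg _))
        (mul_le_of_le_one_right hγ0 (hdiam _ (hx t ht) _ (hxpX t ht))) 2
    have hquad := mul_le_mul_of_nonneg_left hnorm (half_pos hL).le
    have hdecr : γ * (⟪f' (x t), xp t⟫ - ⟪f' (x t), x t⟫) ≤ γ * (f xstar - f (x t)) :=
      mul_le_mul_of_nonneg_left (by linarith) hγ0
    linarith
  intro t ht
  induction t, ht using Nat.le_induction with
  | base =>
    have h := hstep 1 le_rfl
    norm_num at h ⊢
    linarith
  | succ t ht ih =>
    have ht' : (2 : ℝ) ≤ t := by exact_mod_cast ht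
    have hγ : 0 ≤ 1 - 2 / ((t : ℝ) + 1) := by
      rw [sub_nonneg, div_le_one (by linarith)]
      linarith
    calc f (x (t + 1)) - f xstar
        ≤ (1 - 2 / ((t : ℝ) + 1)) * (2 * L / ((t : ℝ) + 1))
          + L / 2 * (2 / ((t : ℝ) + 1)) ^ 2 :=
          (hstep t (by omega)).trans (by gcongr)
      _ = 2 * L * t / ((t : ℝ) + 1) ^ 2 := by
          field_simp
          ring
      _ ≤ 2 * L / (((t + 1 : ℕ) : ℝ) + 1) := by
          push_cast
          rw [div_le_div_iff₀ (by positivity) (by positivity)]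
          nlinarith
end

section
/- For a generic Conditional Gradient sequence (x_t) on X, with f_*^t = max_{1≤k≤t} [f(x_k) − ⟨f'(x_k), x_k − x_k⁺⟩] and x̄_t a point among x_1,...,x_t with the smallest value of f, one has f(x̄_t) − f_*^t ≤ 4.5 L/(t−2) for every t ≥ 5. -/
open RealInnerProductSpace

/-- The recurrence `δ_{k+1} ≤ (1 - γ_k) δ_k + (L/2) γ_k²` with `γ_k = 2/(k+1)` forces
`δ_k ≤ 2L/k` for `k ≥ 2`, here in a division-free form with `k = n + 1`. -/
lemma mul_le_of_conditionalGradient_recurrence {δ : ℕ → ℝ} {L : ℝ} (hL : 0 ≤ L) {t : ℕ}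
    (h : ∀ k : ℕ, 1 ≤ k → k < t → δ (k + 1) ≤
      (1 - 2 / ((k : ℝ) + 1)) * δ k + L / 2 * (2 / ((k : ℝ) + 1)) ^ 2) (n : ℕ) (hn : n < t) :
    (n : ℝ) * ((n : ℝ) + 1) * δ (n + 1) ≤ 2 * L * n := by
  induction n with
  | zero => simp
  | succ n ih =>
    have hprev := ih (by omega)
    have hstep := h (n + 1) (by omega) hn
    push_cast at hstep ⊢
    have hpos : (0 : ℝ) < (n : ℝ) + 1 + 1 := by positivity
    have hmul := mul_le_mul_of_nonneg_left hstep
      (by positivity : (0 : ℝ) ≤ ((n : ℝ) + 1) * ((n : ℝ) + 1 + 1))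
    have heq : ((n : ℝ) + 1) * ((n : ℝ) + 1 + 1) *
        ((1 - 2 / ((n : ℝ) + 1 + 1)) * δ (n + 1) + L / 2 * (2 / ((n : ℝ) + 1 + 1)) ^ 2) =
        (n : ℝ) * ((n : ℝ) + 1) * δ (n + 1) + 2 * L * (((n : ℝ) + 1) / ((n : ℝ) + 1 + 1)) := by
      field_simp
      ring
    have hfrac : 2 * L * (((n : ℝ) + 1) / ((n : ℝ) + 1 + 1)) ≤ 2 * L * 1 := by
      gcongr
      rw [div_le_one hpos]
      linarith
    linarith

/-- For a generic Conditional Gradient sequence `(x_t)` on `X`, with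
`f_*^t = max_{1≤k≤t} [f(x_k) − ⟨f'(x_k), x_k − x_k⁺⟩]` and `x̄_t` a point among `x_1,...,x_t`
with the smallest value of `f`, one has `f(x̄_t) − f_*^t ≤ 4.5 L/(t−2)` for every `t ≥ 5`. -/
theorem cndg_certificate_rate
    {E : Type*} [NormedAddCommGroup E] [InnerProductSpace ℝ E] [FiniteDimensional ℝ E]
    (X : Set E) (hXne : X.Nonempty) (hXcpt : IsCompact X) (hXconv : Convex ℝ X)
    (nX : E → ℝ)
    (hn0 : ∀ v : E, nX v = 0 ↔ v = 0)
    (hnhom : ∀ (a : ℝ) (v : E), nX (a • v) = |a| * nX v)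
    (hntri : ∀ v w : E, nX (v + w) ≤ nX v + nX w)
    (hdiam : ∀ x ∈ X, ∀ y ∈ X, nX (y - x) ≤ 1)
    (f : E → ℝ) (f' : E → E) (L : ℝ) (hL : 0 < L)
    (hconv : ConvexOn ℝ X f)
    (hdiff : ∀ x ∈ X, HasGradientAt f (f' x) x)
    (hsmooth : ∀ x ∈ X, ∀ y ∈ X,
      f y ≤ f x + ⟪f' x, y - x⟫ + L / 2 * nX (y - x) ^ 2)
    (x xp : ℕ → E)
    (hx : ∀ t : ℕ, 1 ≤ t → x t ∈ X)
    (hxpX : ∀ t : ℕ, 1 ≤ t → xp t ∈ X)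
    (hxpmin : ∀ t : ℕ, 1 ≤ t → ∀ y ∈ X, ⟪f' (x t), xp t⟫ ≤ ⟪f' (x t), y⟫)
    (hrec : ∀ t : ℕ, 1 ≤ t →
      f (x (t + 1)) ≤ f (x t + ((2 : ℝ) / ((t : ℝ) + 1)) • (xp t - x t)))
    (xbar : ℕ → E)
    (hxbar : ∀ t : ℕ, 1 ≤ t → ∃ k : ℕ, 1 ≤ k ∧ k ≤ t ∧ xbar t = x k)
    (hxbarmin : ∀ t k : ℕ, 1 ≤ k → k ≤ t → f (xbar t) ≤ f (x k)) :
    ∀ t : ℕ, ∀ ht : 5 ≤ t,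
      f (xbar t) -
        (Finset.Icc 1 t).sup' (Finset.nonempty_Icc.mpr (by omega))
          (fun k => f (x k) - ⟪f' (x k), x k - xp k⟫)
      ≤ 4.5 * L / ((t : ℝ) - 2) := by
  intro t ht
  set A := (Finset.Icc 1 t).sup' (Finset.nonempty_Icc.mpr (by omega))
    (fun k => f (x k) - ⟪f' (x k), x k - xp k⟫)
  have hgap : ∀ k : ℕ, 1 ≤ k → k ≤ t → f (x k) - ⟪f' (x k), x k - xp k⟫ ≤ A := fun k h1 h2 =>
    Finset.le_sup' (fun k => f (x k) - ⟪f' (x k), x k - xp k⟫) (Finset.mem_Icc.mpr ⟨h1, h2⟩)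
  have hnonneg : ∀ v : E, 0 ≤ nX v := by
    intro v
    have h1 := hntri v ((-1 : ℝ) • v)
    have h2 : v + (-1 : ℝ) • v = 0 := by simp
    rw [h2, hnhom, (hn0 0).mpr rfl, abs_neg, abs_one] at h1
    linarith
  have hrecur : ∀ k : ℕ, 1 ≤ k → k < t → f (x (k + 1)) - A ≤
      (1 - 2 / ((k : ℝ) + 1)) * (f (x k) - A) + L / 2 * (2 / ((k : ℝ) + 1)) ^ 2 := by
    intro k h1 h2
    have hk : (1 : ℝ) ≤ k := by exact_mod_cast h1
    have hstep := hrec k h1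
    set γ : ℝ := 2 / ((k : ℝ) + 1) with hγ
    have hγ0 : 0 ≤ γ := by positivity
    have hγ1 : γ ≤ 1 := by
      rw [hγ, div_le_one (by positivity)]
      linarith
    have hmem := hXconv.add_smul_sub_mem (hx k h1) (hxpX k h1) ⟨hγ0, hγ1⟩
    have hs := hsmooth _ (hx k h1) _ hmem
    have hinner : ⟪f' (x k), xp k - x k⟫ = -⟪f' (x k), x k - xp k⟫ := by
      rw [← inner_neg_right, neg_sub]
    rw [add_sub_cancel_left, inner_smul_right, hinner, hnhom, abs_of_nonneg hγ0, mul_pow] at hs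
    have hsq : nX (xp k - x k) ^ 2 ≤ 1 :=
      pow_le_one₀ (hnonneg _) (hdiam _ (hx k h1) _ (hxpX k h1))
    have hquad : L / 2 * (γ ^ 2 * nX (xp k - x k) ^ 2) ≤ L / 2 * (γ ^ 2 * 1) := by gcongr
    have hlin := mul_le_mul_of_nonneg_left (hgap k h1 h2.le) hγ0
    linarith
  obtain ⟨n, rfl⟩ : ∃ n, t = n + 1 := ⟨t - 1, by omega⟩
  have hbound := mul_le_of_conditionalGradient_recurrence (δ := fun k => f (x k) - A) hL.le
    hrecur n (by omega)
  have hn : (4 : ℝ) ≤ n := by exact_mod_cast (by omega : 4 ≤ n)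
  have hlast : f (x (n + 1)) - A ≤ 2 * L / ((n : ℝ) + 1) := by
    rw [le_div_iff₀ (by positivity)]
    refine le_of_mul_le_mul_left ?_ (by linarith : (0 : ℝ) < n)
    linarith
  calc f (xbar (n + 1)) - A ≤ f (x (n + 1)) - A :=
        sub_le_sub_right (hxbarmin (n + 1) (n + 1) (by omega) le_rfl) A
    _ ≤ 2 * L / ((n : ℝ) + 1) := hlast
    _ ≤ 4.5 * L / (((n + 1 : ℕ) : ℝ) - 2) := by
      push_cast
      gcongr
      · linarith
      · norm_num
      · linarith
end

section
/- Let ρ ≥ 0, η ∈ E, σ ∈ ℝ, and let x[η] ∈ Argmin{⟨η, x⟩ : x ∈ K, ‖x‖ ≤ 1}. Define z⁺ = ρ·[x[η]; 1] if ⟨η, x[η]⟩ + σ ≤ 0, and z⁺ = 0 otherwise. Then z⁺ minimizes the linear form ℓ([x;r]) = ⟨η, x⟩ + σr over the set K⁺[ρ] = {[x;r] ∈ E × ℝ : x ∈ K, ‖x‖ ≤ r ≤ ρ}. In particular, when σ = 0, the point ρ·[x[η]; 1] is such a minimizer. -/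
open RealInnerProductSpace

/-- A function on a real vector space that is absolutely homogeneous and subadditive is
nonnegative. -/
theorem nonneg_of_abs_homogeneous_of_subadditive {E : Type*} [AddCommGroup E] [Module ℝ E]
    {nE : E → ℝ} (hnhom : ∀ (a : ℝ) (v : E), nE (a • v) = |a| * nE v)
    (hntri : ∀ v w : E, nE (v + w) ≤ nE v + nE w) (v : E) : 0 ≤ nE v := by
  have h0 : nE 0 = 0 := by simpa using hnhom 0 v
  have hneg : nE (-v) = nE v := by simpa using hnhom (-1) v
  have h := hntri v (-v)
  rw [add_neg_cancel, h0, hneg] at h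
  linarith

/-- If `x` minimizes `⟪η, ·⟫` over the part of a cone in the unit ball of a norm, then `r • x`
bounds `⟪η, ·⟫` from below over the part of the cone in the ball of radius `r`. -/
theorem mul_inner_le_inner_of_forall_mem_cone {E : Type*} [NormedAddCommGroup E]
    [InnerProductSpace ℝ E] {nE : E → ℝ} (hn0 : ∀ v : E, nE v = 0 → v = 0)
    (hnhom : ∀ (a : ℝ) (v : E), nE (a • v) = |a| * nE v) (hnonneg : ∀ v : E, 0 ≤ nE v)
    {K : Set E} (hKcone : ∀ c : ℝ, 0 ≤ c → ∀ v ∈ K, c • v ∈ K) {η x : E}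
    (hmin : ∀ v ∈ K, nE v ≤ 1 → ⟪η, x⟫ ≤ ⟪η, v⟫) {v : E} {r : ℝ} (hv : v ∈ K)
    (hvr : nE v ≤ r) : r * ⟪η, x⟫ ≤ ⟪η, v⟫ := by
  rcases ((hnonneg v).trans hvr).eq_or_lt with rfl | hr
  · simp [hn0 v (le_antisymm hvr (hnonneg v))]
  · have h := hmin (r⁻¹ • v) (hKcone _ (inv_nonneg.2 hr.le) v hv) (by
      rw [hnhom, abs_of_pos (inv_pos.2 hr)]
      exact inv_mul_le_one_of_le₀ hvr hr.le)
    rwa [real_inner_smul_right, le_inv_mul_iff₀ hr] at h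

/-- Let `ρ ≥ 0`, `η ∈ E`, `σ ∈ ℝ`, and let `x[η]` minimize `⟨η, ·⟩` over
`{x ∈ K : ‖x‖ ≤ 1}`.  Define `z⁺ = ρ·[x[η]; 1]` if `⟨η, x[η]⟩ + σ ≤ 0`, and `z⁺ = 0`
otherwise.  Then `z⁺` minimizes `ℓ([x;r]) = ⟨η, x⟩ + σ r` over
`K⁺[ρ] = {[x;r] : x ∈ K, ‖x‖ ≤ r ≤ ρ}`; in particular, when `σ = 0`, the point
`ρ·[x[η]; 1]` is such a minimizer. -/
theorem cndg_lo_oracle_lift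
    {E : Type*} [NormedAddCommGroup E] [InnerProductSpace ℝ E] [FiniteDimensional ℝ E]
    (nE : E → ℝ)
    (hn0 : ∀ v : E, nE v = 0 ↔ v = 0)
    (hnhom : ∀ (a : ℝ) (v : E), nE (a • v) = |a| * nE v)
    (hntri : ∀ v w : E, nE (v + w) ≤ nE v + nE w)
    (K : Set E) (hKcl : IsClosed K) (hKconv : Convex ℝ K)
    (hKcone : ∀ c : ℝ, 0 ≤ c → ∀ v ∈ K, c • v ∈ K) (hK0 : (0 : E) ∈ K)
    (ρ : ℝ) (hρ : 0 ≤ ρ) (η : E) (σ : ℝ)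
    (xη : E) (hxη : xη ∈ K) (hxη1 : nE xη ≤ 1)
    (hxηmin : ∀ v ∈ K, nE v ≤ 1 → ⟪η, xη⟫ ≤ ⟪η, v⟫) :
    (⟪η, xη⟫ + σ ≤ 0 →
      ((ρ • xη ∈ K ∧ nE (ρ • xη) ≤ ρ ∧ ρ ≤ ρ) ∧
        ∀ v : E, ∀ r : ℝ, v ∈ K → nE v ≤ r → r ≤ ρ →
          ⟪η, ρ • xη⟫ + σ * ρ ≤ ⟪η, v⟫ + σ * r)) ∧
    (¬ (⟪η, xη⟫ + σ ≤ 0) →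
      (((0 : E) ∈ K ∧ nE (0 : E) ≤ 0 ∧ (0 : ℝ) ≤ ρ) ∧
        ∀ v : E, ∀ r : ℝ, v ∈ K → nE v ≤ r → r ≤ ρ →
          ⟪η, (0 : E)⟫ + σ * 0 ≤ ⟪η, v⟫ + σ * r)) ∧
    (σ = 0 →
      ((ρ • xη ∈ K ∧ nE (ρ • xη) ≤ ρ ∧ ρ ≤ ρ) ∧
        ∀ v : E, ∀ r : ℝ, v ∈ K → nE v ≤ r → r ≤ ρ →
          ⟪η, ρ • xη⟫ + σ * ρ ≤ ⟪η, v⟫ + σ * r)) := by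
  have hnonneg := nonneg_of_abs_homogeneous_of_subadditive hnhom hntri
  have key : ∀ v : E, ∀ r : ℝ, v ∈ K → nE v ≤ r → r * ⟪η, xη⟫ ≤ ⟪η, v⟫ := fun v r hv hvr =>
    mul_inner_le_inner_of_forall_mem_cone (fun w => (hn0 w).1) hnhom hnonneg hKcone hxηmin hv hvr
  have hlift : ⟪η, xη⟫ + σ ≤ 0 →
      ((ρ • xη ∈ K ∧ nE (ρ • xη) ≤ ρ ∧ ρ ≤ ρ) ∧
        ∀ v : E, ∀ r : ℝ, v ∈ K → nE v ≤ r → r ≤ ρ →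
          ⟪η, ρ • xη⟫ + σ * ρ ≤ ⟪η, v⟫ + σ * r) := by
    refine fun hle => ⟨⟨hKcone ρ hρ xη hxη, ?_, le_rfl⟩, fun v r hv hvr hrρ => ?_⟩
    · rw [hnhom, abs_of_nonneg hρ]
      exact mul_le_of_le_one_right hρ hxη1
    · rw [real_inner_smul_right]
      linarith [key v r hv hvr, mul_le_mul_of_nonpos_right hrρ hle]
  refine ⟨hlift, fun hlt => ⟨⟨hK0, ((hn0 0).2 rfl).le, hρ⟩, fun v r hv hvr _ => ?_⟩,
    fun hσ => hlift ?_⟩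
  · rw [inner_zero_right]
    linarith [key v r hv hvr, mul_nonneg ((hnonneg v).trans hvr) (not_le.1 hlt).le]
  · simpa [hσ] using hxηmin 0 hK0 (by simp [(hn0 0).2 rfl])
end

section
/- Let ρ > 0, ε > 0, X = {x ∈ K : ‖x‖ ≤ ρ}, and let (x_t) be a generic Conditional Gradient sequence for f on X, with f_*^t = max_{1≤k≤t}[f(x_k) − ⟨f'(x_k), x_k − x_k⁺⟩] and x̄_t a point among x_1,...,x_t minimizing f. If at some step t both f(x̄_t) > ε and f_*^t < (3/4) f(x̄_t), then t ≤ max[5, 2 + 72 ρ² L_f / ε]. Consequently, the number of steps of a stage of the parametric-optimization CndG algorithm with radius ρ ≤ ρ_* does not exceed max[6, 72 ρ_*² L_f/ε + 3]. -/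
open RealInnerProductSpace

/-- Unrolling the Conditional Gradient recursion with step sizes `2 / (k + 1)`. -/
lemma mul_le_of_cndg_recursion {d : ℕ → ℝ} {A C : ℝ} (hC : 0 ≤ C) {t : ℕ}
    (h : ∀ k : ℕ, 1 ≤ k → k < t →
      d (k + 1) ≤ (1 - 2 / ((k : ℝ) + 1)) * d k - 2 / ((k : ℝ) + 1) * A
        + C * (2 / ((k : ℝ) + 1)) ^ 2)
    {k : ℕ} (hk : 1 ≤ k) (hkt : k ≤ t) :
    ((k : ℝ) - 1) * k * d k ≤ ((k : ℝ) - 1) * (4 * C - k * A) := by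
  induction k, hk using Nat.le_induction with
  | base => simp
  | succ k hk ih =>
    have ih := ih (by omega)
    have hstep := h k hk (by omega)
    have hkpos : (1 : ℝ) ≤ k := by exact_mod_cast hk
    have hmul := mul_le_mul_of_nonneg_left hstep
      (by positivity : (0 : ℝ) ≤ (k : ℝ) * ((k : ℝ) + 1))
    have hexpand : (k : ℝ) * ((k : ℝ) + 1) *
        ((1 - 2 / ((k : ℝ) + 1)) * d k - 2 / ((k : ℝ) + 1) * A
          + C * (2 / ((k : ℝ) + 1)) ^ 2)
        = ((k : ℝ) - 1) * k * d k - 2 * k * A + 4 * C * (k / ((k : ℝ) + 1)) := by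
      field_simp
      ring
    have hfrac : (k : ℝ) / ((k : ℝ) + 1) ≤ 1 := by
      rw [div_le_one (by positivity)]
      linarith
    have hCfrac := mul_le_mul_of_nonneg_left hfrac (by positivity : 0 ≤ 4 * C)
    rw [hexpand] at hmul
    push_cast
    nlinarith

/-- Along a segment inside the part of a convex set lying in the `nE`-ball of radius `ρ`, a smooth
function satisfies the quadratic upper bound with constant `4 * ρ ^ 2 * Lf`. -/
lemma cndg_descent
    {E : Type*} [NormedAddCommGroup E] [InnerProductSpace ℝ E] {nE : E → ℝ}
    (hnhom : ∀ (a : ℝ) (v : E), nE (a • v) = |a| * nE v)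
    (hntri : ∀ v w : E, nE (v + w) ≤ nE v + nE w)
    {K : Set E} (hKconv : Convex ℝ K) {f : E → ℝ} {f' : E → E} {Lf : ℝ} (hLf : 0 ≤ Lf)
    (hsmooth : ∀ v ∈ K, ∀ w ∈ K,
      f w ≤ f v + ⟪f' v, w - v⟫ + Lf / 2 * nE (w - v) ^ 2)
    {ρ γ : ℝ} (hγ0 : 0 ≤ γ) (hγ1 : γ ≤ 1) {v w : E} (hv : v ∈ K) (hw : w ∈ K)
    (hvρ : nE v ≤ ρ) (hwρ : nE w ≤ ρ) :
    f (v + γ • (w - v)) ≤ f v - γ * ⟪f' v, v - w⟫ + 2 * ρ ^ 2 * Lf * γ ^ 2 := by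
  have hneg : ∀ u : E, nE (-u) = nE u := fun u => by simpa using hnhom (-1) u
  have hzero : nE 0 = 0 := by simpa using hnhom 0 0
  have hnonneg : ∀ u : E, 0 ≤ nE u := fun u => by
    have := hntri u (-u)
    rw [add_neg_cancel, hzero, hneg] at this
    linarith
  have hdist : nE (w - v) ≤ 2 * ρ := by
    have := hntri w (-v)
    rw [hneg, ← sub_eq_add_neg] at this
    linarith
  have hsq : nE (w - v) ^ 2 ≤ (2 * ρ) ^ 2 := pow_le_pow_left₀ (hnonneg _) hdist 2
  have hmem : v + γ • (w - v) ∈ K := hKconv.add_smul_sub_mem hv hw ⟨hγ0, hγ1⟩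
  have hbound := hsmooth v hv _ hmem
  rw [add_sub_cancel_left, hnhom, inner_smul_right, mul_pow, sq_abs, ← neg_sub v w,
    inner_neg_right, neg_sub v w] at hbound
  have := mul_le_mul_of_nonneg_left hsq (by positivity : 0 ≤ Lf / 2 * γ ^ 2)
  linarith

/-- Let `ρ > 0`, `ε > 0`, `X = {x ∈ K : ‖x‖ ≤ ρ}`, and let `(x_t)` be a
generic Conditional Gradient sequence for `f` on `X`, with
`f_*^t = max_{1≤k≤t}[f(x_k) − ⟨f'(x_k), x_k − x_k⁺⟩]` and `x̄_t` a point among `x_1,...,x_t`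
minimizing `f`.  If at some step `t` both `f(x̄_t) > ε` and `f_*^t < (3/4) f(x̄_t)`, then
`t ≤ max[5, 2 + 72 ρ² L_f / ε]`.  Consequently, the number of steps of a stage of the
parametric-optimization CndG algorithm with radius `ρ ≤ ρ_*` does not exceed
`max[6, 72 ρ_*² L_f/ε + 3]`. -/
theorem cndg_stage_length
    {E : Type*} [NormedAddCommGroup E] [InnerProductSpace ℝ E] [FiniteDimensional ℝ E]
    (nE : E → ℝ)
    (hn0 : ∀ v : E, nE v = 0 ↔ v = 0)
    (hnhom : ∀ (a : ℝ) (v : E), nE (a • v) = |a| * nE v)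
    (hntri : ∀ v w : E, nE (v + w) ≤ nE v + nE w)
    (K : Set E) (hKcl : IsClosed K) (hKconv : Convex ℝ K)
    (hKcone : ∀ c : ℝ, 0 ≤ c → ∀ v ∈ K, c • v ∈ K) (hK0 : (0 : E) ∈ K)
    (f : E → ℝ) (f' : E → E) (Lf : ℝ) (hLf : 0 < Lf)
    (hconv : ConvexOn ℝ K f)
    (hdiff : ∀ v ∈ K, HasGradientAt f (f' v) v)
    (hsmooth : ∀ v ∈ K, ∀ w ∈ K,
      f w ≤ f v + ⟪f' v, w - v⟫ + Lf / 2 * nE (w - v) ^ 2)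
    (ρ ε : ℝ) (hρ : 0 < ρ) (hε : 0 < ε)
    (X : Set E) (hX : X = {v : E | v ∈ K ∧ nE v ≤ ρ})
    (x xp : ℕ → E)
    (hx : ∀ t : ℕ, 1 ≤ t → x t ∈ X)
    (hxpX : ∀ t : ℕ, 1 ≤ t → xp t ∈ X)
    (hxpmin : ∀ t : ℕ, 1 ≤ t → ∀ y ∈ X, ⟪f' (x t), xp t⟫ ≤ ⟪f' (x t), y⟫)
    (hrec : ∀ t : ℕ, 1 ≤ t →
      f (x (t + 1)) ≤ f (x t + ((2 : ℝ) / ((t : ℝ) + 1)) • (xp t - x t)))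
    (xbar : ℕ → E)
    (hxbar : ∀ t : ℕ, 1 ≤ t → ∃ k : ℕ, 1 ≤ k ∧ k ≤ t ∧ xbar t = x k)
    (hxbarmin : ∀ t k : ℕ, 1 ≤ k → k ≤ t → f (xbar t) ≤ f (x k)) :
    ∀ t : ℕ, ∀ ht : 1 ≤ t,
      ε < f (xbar t) →
      (Finset.Icc 1 t).sup' (Finset.nonempty_Icc.mpr ht)
          (fun k => f (x k) - ⟪f' (x k), x k - xp k⟫) < 3 / 4 * f (xbar t) →
      (t : ℝ) ≤ max 5 (2 + 72 * ρ ^ 2 * Lf / ε) ∧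
      ∀ ρstar : ℝ, ρ ≤ ρstar →
        (t : ℝ) + 1 ≤ max 6 (72 * ρstar ^ 2 * Lf / ε + 3) := by
  intro t ht hεt hsup
  set F := f (xbar t)
  have hgap : ∀ k : ℕ, 1 ≤ k → k ≤ t → f (x k) - ⟪f' (x k), x k - xp k⟫ < 3 / 4 * F :=
    fun k hk hkt => (Finset.sup'_lt_iff _).mp hsup k (Finset.mem_Icc.mpr ⟨hk, hkt⟩)
  subst hX
  have hrecursion : ∀ k : ℕ, 1 ≤ k → k < t →
      f (x (k + 1)) - F ≤ (1 - 2 / ((k : ℝ) + 1)) * (f (x k) - F)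
        - 2 / ((k : ℝ) + 1) * (F / 4) + 2 * ρ ^ 2 * Lf * (2 / ((k : ℝ) + 1)) ^ 2 := by
    intro k hk hkt
    have hk1 : (1 : ℝ) ≤ k := by exact_mod_cast hk
    have hγ0 : (0 : ℝ) ≤ 2 / ((k : ℝ) + 1) := by positivity
    have hγ1 : (2 : ℝ) / ((k : ℝ) + 1) ≤ 1 := by
      rw [div_le_one (by positivity)]
      linarith
    have hdescent := cndg_descent hnhom hntri hKconv hLf.le hsmooth hγ0 hγ1
      (hx k hk).1 (hxpX k hk).1 (hx k hk).2 (hxpX k hk).2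
    have := mul_le_mul_of_nonneg_left (hgap k hk hkt.le).le hγ0
    linarith [hrec k hk]
  have hD : 0 ≤ ρ ^ 2 * Lf / ε := by positivity
  have hmain : (t : ℝ) ≤ max 5 (2 + 72 * ρ ^ 2 * Lf / ε) := by
    rcases ht.eq_or_lt with rfl | ht1
    · exact le_max_of_le_left (by norm_num)
    · have ht1' : (1 : ℝ) < t := by exact_mod_cast ht1
      have hunrolled := mul_le_of_cndg_recursion (d := fun k => f (x k) - F)
        (by positivity) hrecursion ht le_rfl
      rw [mul_assoc] at hunrolled
      have hle := le_of_mul_le_mul_left hunrolled (by linarith)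
      have hδ : 0 ≤ (t : ℝ) * (f (x t) - F) :=
        mul_nonneg (by positivity) (sub_nonneg.mpr (hxbarmin t t ht le_rfl))
      have htε : (t : ℝ) * ε ≤ t * F := mul_le_mul_of_nonneg_left hεt.le (by positivity)
      have htle : (t : ℝ) ≤ 32 * (ρ ^ 2 * Lf) / ε := by
        rw [le_div_iff₀ hε]
        linarith
      refine le_max_of_le_right ?_
      rw [mul_div_assoc] at htle
      rw [mul_assoc 72, mul_div_assoc]
      linarith
  refine ⟨hmain, fun ρstar hρstar => ?_⟩
  have hmono : 72 * ρ ^ 2 * Lf / ε ≤ 72 * ρstar ^ 2 * Lf / ε := by gcongr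
  rcases le_max_iff.mp hmain with h | h
  · exact le_max_of_le_left (by linarith)
  · exact le_max_of_le_right (by linarith)
end

section
/- Let ε > 0, ρ_* > 0, let S ≥ 1 be an integer, and let Opt : [0, ∞) → ℝ be a convex function with Opt(ρ_*) ≤ 0. Suppose that reals 0 < ρ_1 ≤ ρ_2 ≤ ... ≤ ρ_S ≤ ρ_* and positive reals u_s, ℓ_s, g_s (1 ≤ s ≤ S) satisfy: (a) u_s > ε and Opt(ρ_s) ≤ u_s; (b) (3/4)u_s ≤ ℓ_s; (c) ℓ_s − g_s(ρ − ρ_s) ≤ Opt(ρ) for all ρ ≥ 0; (d) ρ_{s+1} − ρ_s ≥ ℓ_s/g_s for 1 ≤ s < S. Then ε ≤ √(4/3) · (2/3)^{S−1} · √(u_1 g_1 ρ_*). -/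
/-- AM-GM step: if the ratios `u' / u` and `g' / g` sum to at most `4 / 3`, their product is at
most `4 / 9`; the hypothesis is stated through a gap `d ≥ (3 / 4) u / g`. -/
theorem mul_le_four_ninths_of_gap {u g u' g' d : ℝ} (hu : 0 < u) (hg : 0 < g) (hg' : 0 < g')
    (hd : 3 / 4 * u ≤ d * g) (h : 3 / 4 * u' + g' * d ≤ u) :
    u' * g' ≤ 4 / 9 * (u * g) := by
  have hsum : u' * g + g' * u ≤ 4 / 3 * (u * g) := by
    nlinarith [mul_le_mul_of_nonneg_left hd hg'.le, mul_le_mul_of_nonneg_right h hg.le]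
  have hug : 0 < u * g := mul_pos hu hg
  have hsq : (u' * g' - 4 / 9 * (u * g)) * (u * g) ≤ 0 := by
    nlinarith [sq_nonneg (g' * u - 2 / 3 * (u * g)),
      mul_le_mul_of_nonneg_right hsum (mul_pos hg' hu).le]
  linarith [nonpos_of_mul_nonpos_left hsq hug]


/-- Let `ε > 0`, `ρ_* > 0`, `S ≥ 1` an integer, and let
`Opt : [0, ∞) → ℝ` be convex with `Opt(ρ_*) ≤ 0`.  Suppose reals
`0 < ρ_1 ≤ ρ_2 ≤ ... ≤ ρ_S ≤ ρ_*` and positive reals `u_s, ℓ_s, g_s` (`1 ≤ s ≤ S`) satisfy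
(a) `u_s > ε` and `Opt(ρ_s) ≤ u_s`; (b) `(3/4)u_s ≤ ℓ_s`;
(c) `ℓ_s − g_s(ρ − ρ_s) ≤ Opt(ρ)` for all `ρ ≥ 0`; (d) `ρ_{s+1} − ρ_s ≥ ℓ_s/g_s` for
`1 ≤ s < S`.  Then `ε ≤ √(4/3) · (2/3)^{S−1} · √(u_1 g_1 ρ_*)`. -/
theorem cndg_stage_count
    (ε ρstar : ℝ) (hε : 0 < ε) (hρstar : 0 < ρstar)
    (S : ℕ) (hS : 1 ≤ S)
    (Opt : ℝ → ℝ) (hOptConv : ConvexOn ℝ (Set.Ici (0 : ℝ)) Opt)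
    (hOptρstar : Opt ρstar ≤ 0)
    (ρ u ℓ g : ℕ → ℝ)
    (hρ1 : 0 < ρ 1)
    (hρmono : ∀ s : ℕ, 1 ≤ s → s < S → ρ s ≤ ρ (s + 1))
    (hρS : ρ S ≤ ρstar)
    (hupos : ∀ s : ℕ, 1 ≤ s → s ≤ S → 0 < u s)
    (hlpos : ∀ s : ℕ, 1 ≤ s → s ≤ S → 0 < ℓ s)
    (hgpos : ∀ s : ℕ, 1 ≤ s → s ≤ S → 0 < g s)
    (ha : ∀ s : ℕ, 1 ≤ s → s ≤ S → ε < u s ∧ Opt (ρ s) ≤ u s)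
    (hb : ∀ s : ℕ, 1 ≤ s → s ≤ S → 3 / 4 * u s ≤ ℓ s)
    (hc : ∀ s : ℕ, 1 ≤ s → s ≤ S → ∀ x : ℝ, 0 ≤ x → ℓ s - g s * (x - ρ s) ≤ Opt x)
    (hd : ∀ s : ℕ, 1 ≤ s → s < S → ℓ s / g s ≤ ρ (s + 1) - ρ s) :
    ε ≤ Real.sqrt (4 / 3) * (2 / 3) ^ (S - 1) * Real.sqrt (u 1 * g 1 * ρstar) := by
  have key : ∀ n : ℕ, n + 1 ≤ S →
      0 < ρ (n + 1) ∧ u (n + 1) * g (n + 1) ≤ (4 / 9) ^ n * (u 1 * g 1) := by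
    intro n
    induction n with
    | zero => exact fun _ => ⟨hρ1, by simp⟩
    | succ n ih =>
      intro hn
      obtain ⟨hρ, hug⟩ := ih (by lia)
      have hg := hgpos (n + 1) (by lia) (by lia)
      have hgap : ℓ (n + 1) ≤ (ρ (n + 1 + 1) - ρ (n + 1)) * g (n + 1) :=
        (div_le_iff₀ hg).mp (hd (n + 1) (by lia) (by lia))
      have hstep := mul_le_four_ninths_of_gap (hupos (n + 1) (by lia) (by lia)) hg
        (u' := u (n + 1 + 1)) (hgpos (n + 1 + 1) (by lia) hn)
        ((hb (n + 1) (by lia) (by lia)).trans hgap)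
        (by linarith [hc (n + 1 + 1) (by lia) hn _ hρ.le, hb (n + 1 + 1) (by lia) hn,
          (ha (n + 1) (by lia) (by lia)).2])
      refine ⟨hρ.trans_le (hρmono (n + 1) (by lia) (by lia)), ?_⟩
      rw [pow_succ]
      linarith
  obtain ⟨n, rfl⟩ : ∃ n, S = n + 1 := ⟨S - 1, by lia⟩
  obtain ⟨hρ, hug⟩ := key n le_rfl
  have hu := hupos (n + 1) hS le_rfl
  have hg := hgpos (n + 1) hS le_rfl
  have hl : 3 / 4 * u (n + 1) ≤ g (n + 1) * ρstar := by
    linarith [hc (n + 1) hS le_rfl ρstar hρstar.le, hb (n + 1) hS le_rfl, mul_pos hg hρ]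
  have hεsq : ε ^ 2 ≤ u (n + 1) ^ 2 :=
    pow_le_pow_left₀ hε.le (ha (n + 1) hS le_rfl).1.le 2
  have hug1 : 0 ≤ u 1 * g 1 * ρstar :=
    (mul_pos (mul_pos (hupos 1 le_rfl hS) (hgpos 1 le_rfl hS)) hρstar).le
  refine (sq_le_sq₀ hε.le (by positivity)).mp ?_
  rw [mul_pow, mul_pow, Real.sq_sqrt (by norm_num), Real.sq_sqrt hug1, Nat.add_sub_cancel,
    pow_right_comm, show ((2 : ℝ) / 3) ^ 2 = 4 / 9 by norm_num]
  linarith [mul_le_mul_of_nonneg_left hl hu.le, mul_le_mul_of_nonneg_right hug hρstar.le]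
end

section
/- Let (z_t), z_t = [x_t; r_t], be a sequence in E × ℝ with z_1 = 0, z_{t+1} ∈ K⁺, and F(z_{t+1}) ≤ min{F(z) : z ∈ Conv(Δ(z_t) ∪ {z_t})} for all t ≥ 1. Then z_t ∈ K⁺ for all t, F(z_{t+1}) ≤ F(z_t) for all t, and F(z_t) − F_* ≤ 8 L_f D_*² / (t + 14) for all t ≥ 2. -/
open RealInnerProductSpace

/-- The gradient inequality for a function that is convex on `K` and differentiable at `x ∈ K`. -/
theorem ConvexOn.add_inner_le_of_hasGradientAt
    {E : Type*} [NormedAddCommGroup E] [InnerProductSpace ℝ E] [CompleteSpace E]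
    {K : Set E} {f : E → ℝ} {g x y : E} (hf : ConvexOn ℝ K f) (hg : HasGradientAt f g x)
    (hx : x ∈ K) (hy : y ∈ K) : f x + ⟪g, y - x⟫ ≤ f y := by
  have hline := hf.comp_affineMap (AffineMap.lineMap x y : ℝ →ᵃ[ℝ] E)
  have hderiv : HasDerivAt (f ∘ (AffineMap.lineMap x y : ℝ →ᵃ[ℝ] E)) ⟪g, y - x⟫ 0 := by
    have h0 : HasFDerivAt f (InnerProductSpace.toDual ℝ E g)
        ((AffineMap.lineMap x y : ℝ →ᵃ[ℝ] E) 0) := by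
      simpa using hg.hasFDerivAt
    simpa using h0.comp_hasDerivAt (0 : ℝ) AffineMap.hasDerivAt_lineMap
  have hslope := hline.le_slope_of_hasDerivAt (x := 0) (y := 1) (by simpa using hx)
    (by simpa using hy) one_pos hderiv
  simp only [slope_def_field, Function.comp_apply, AffineMap.lineMap_apply_one,
    AffineMap.lineMap_apply_zero, sub_zero, div_one] at hslope
  linarith

/-- A minimizer of a linear form over the unit part of a cone, scaled by `r`, is at least as good
as any point of the cone of size at most `r`. -/
theorem inner_smul_le_of_isMinOn_cone
    {E : Type*} [NormedAddCommGroup E] [InnerProductSpace ℝ E] {nE : E → ℝ}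
    (hn0 : ∀ v : E, nE v = 0 ↔ v = 0) (hnn : ∀ v : E, 0 ≤ nE v)
    (hnhom : ∀ (a : ℝ) (v : E), nE (a • v) = |a| * nE v)
    {K : Set E} (hKcone : ∀ c : ℝ, 0 ≤ c → ∀ v ∈ K, c • v ∈ K)
    {η o : E} (hmin : ∀ v ∈ K, nE v ≤ 1 → ⟪η, o⟫ ≤ ⟪η, v⟫)
    {v : E} (hv : v ∈ K) {r : ℝ} (hvr : nE v ≤ r) : ⟪η, r • o⟫ ≤ ⟪η, v⟫ := by
  rcases ((hnn v).trans hvr).eq_or_lt with rfl | hr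
  · simp [(hn0 v).1 (le_antisymm hvr (hnn v))]
  · have h := hmin (r⁻¹ • v) (hKcone _ (by positivity) v hv) (by
      rw [hnhom, abs_of_pos (by positivity), inv_mul_le_iff₀ hr]
      simpa using hvr)
    rw [inner_smul_right, inv_mul_eq_div, le_div_iff₀ hr] at h
    rw [inner_smul_right]
    linarith

/-- Let `(z_t)`, `z_t = [x_t; r_t]`, be a sequence in `E × ℝ` with `z_1 = 0`,
`z_{t+1} ∈ K⁺`, and `F(z_{t+1}) ≤ min{F(z) : z ∈ Conv(Δ(z_t) ∪ {z_t})}` for all `t ≥ 1`.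
Then `z_t ∈ K⁺` for all `t`, `F(z_{t+1}) ≤ F(z_t)` for all `t`, and
`F(z_t) − F_* ≤ 8 L_f D_*² / (t + 14)` for all `t ≥ 2`. -/
theorem cocndg_rate
    {E : Type*} [NormedAddCommGroup E] [InnerProductSpace ℝ E] [FiniteDimensional ℝ E]
    (nE : E → ℝ)
    (hn0 : ∀ v : E, nE v = 0 ↔ v = 0)
    (hnhom : ∀ (a : ℝ) (v : E), nE (a • v) = |a| * nE v)
    (hntri : ∀ v w : E, nE (v + w) ≤ nE v + nE w)
    (K : Set E) (hKcl : IsClosed K) (hKconv : Convex ℝ K)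
    (hKcone : ∀ c : ℝ, 0 ≤ c → ∀ v ∈ K, c • v ∈ K) (hK0 : (0 : E) ∈ K)
    (κ Lf : ℝ) (hκ : 0 < κ) (hLf : 0 < Lf)
    (f : E → ℝ) (f' : E → E)
    (hconv : ConvexOn ℝ K f)
    (hdiff : ∀ v : E, HasGradientAt f (f' v) v)
    (hsmooth : ∀ v ∈ K, ∀ w ∈ K,
      f w ≤ f v + ⟪f' v, w - v⟫ + Lf / 2 * nE (w - v) ^ 2)
    -- the Linear Optimization oracle for `(K, ‖·‖)`
    (oracle : E → E)
    (horK : ∀ η : E, oracle η ∈ K)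
    (hor1 : ∀ η : E, nE (oracle η) ≤ 1)
    (hormin : ∀ η : E, ∀ v ∈ K, nE v ≤ 1 → ⟪η, oracle η⟫ ≤ ⟪η, v⟫)
    -- Assumption A, with `Dstar` playing the role of `D_*` and `Dplus` of `D⁺ ≥ D_*`
    (Dstar Dplus : ℝ)
    (hDstar : ∀ (v : E) (r : ℝ), v ∈ K → nE v ≤ r → κ * r + f v ≤ f 0 → r ≤ Dstar)
    (hDplus : Dstar ≤ Dplus)
    -- the composite objective `F` and the cone `K⁺`
    (F : E × ℝ → ℝ) (hF : ∀ z : E × ℝ, F z = κ * z.2 + f z.1)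
    (Kplus : Set (E × ℝ)) (hKplus : Kplus = {z : E × ℝ | z.1 ∈ K ∧ nE z.1 ≤ z.2})
    -- `F_* = F(z_*)` is the minimum of `F` on `K⁺`
    (zstar : E × ℝ) (hzstarK : zstar ∈ Kplus) (hzstarmin : ∀ z ∈ Kplus, F zstar ≤ F z)
    -- the generic COCndG sequence
    (z : ℕ → E × ℝ) (hz1 : z 1 = 0)
    (hzK : ∀ t : ℕ, 1 ≤ t → z (t + 1) ∈ Kplus)
    (hzrec : ∀ t : ℕ, 1 ≤ t → ∀ w ∈ convexHull ℝ
        (((fun ρ : ℝ => ((ρ • oracle (f' (z t).1), ρ) : E × ℝ)) '' Set.Icc (0 : ℝ) Dplus)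
          ∪ {z t}),
        F (z (t + 1)) ≤ F w) :
    (∀ t : ℕ, 1 ≤ t → z t ∈ Kplus) ∧
    (∀ t : ℕ, 1 ≤ t → F (z (t + 1)) ≤ F (z t)) ∧
    (∀ t : ℕ, 2 ≤ t → F (z t) - F zstar ≤ 8 * Lf * Dstar ^ 2 / ((t : ℝ) + 14)) := by
  have hnn : ∀ v : E, 0 ≤ nE v := fun v => by
    have h := hntri v ((-1 : ℝ) • v)
    rw [hnhom, neg_one_smul, add_neg_cancel, (hn0 0).2 rfl] at h
    norm_num at h
    linarith
  subst hKplus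
  have hmem : ∀ t : ℕ, 1 ≤ t → (z t).1 ∈ K ∧ nE (z t).1 ≤ (z t).2 := by
    intro t ht
    obtain rfl | ⟨s, hs, rfl⟩ : t = 1 ∨ ∃ s, 1 ≤ s ∧ t = s + 1 := by
      rcases ht.eq_or_lt with h | h
      · exact Or.inl h.symm
      · exact Or.inr ⟨t - 1, by lia, by lia⟩
    · rw [hz1]
      exact ⟨hK0, ((hn0 0).2 rfl).le⟩
    · exact hzK s hs
  have hmono : ∀ t : ℕ, 1 ≤ t → F (z (t + 1)) ≤ F (z t) := fun t ht =>
    hzrec t ht _ (subset_convexHull ℝ _ (Or.inr rfl))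
  have hinit : F (z 1) = f 0 := by simp [hF, hz1]
  have hbound : ∀ t : ℕ, 1 ≤ t → F (z t) ≤ f 0 := by
    intro t ht
    induction t, ht using Nat.le_induction with
    | base => exact hinit.le
    | succ t ht ih => exact (hmono t ht).trans ih
  have hradius : ∀ t : ℕ, 1 ≤ t → (z t).2 ≤ Dstar := fun t ht =>
    hDstar _ _ (hmem t ht).1 (hmem t ht).2 (hF (z t) ▸ hbound t ht)
  obtain ⟨hxK, hxr⟩ := hzstarK
  have hr0 : 0 ≤ zstar.2 := (hnn _).trans hxr
  have hrD : zstar.2 ≤ Dstar := by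
    refine hDstar _ _ hxK hxr ?_
    rw [← hF, ← hinit]
    exact hzstarmin _ (hmem 1 le_rfl)
  -- One step of the method, compared with the segment towards the optimal radius.
  have hstep : ∀ t : ℕ, 1 ≤ t → ∀ γ : ℝ, 0 ≤ γ → γ ≤ 1 →
      F (z (t + 1)) - F zstar ≤ (1 - γ) * (F (z t) - F zstar)
        + Lf / 2 * γ ^ 2 * (zstar.2 + (z t).2) ^ 2 := by
    intro t ht γ hγ0 hγ1
    obtain ⟨hx, hr⟩ := hmem t ht
    set x := (z t).1
    set r := (z t).2
    set o := oracle (f' x)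
    have hoK : zstar.2 • o ∈ K := hKcone _ hr0 _ (horK _)
    set w : E × ℝ := (1 - γ) • z t + γ • (zstar.2 • o, zstar.2)
    have hw : F (z (t + 1)) ≤ F w := hzrec t ht w <| by
      have hzt := subset_convexHull ℝ (((fun ρ : ℝ => ((ρ • oracle (f' (z t).1), ρ) : E × ℝ)) ''
        Set.Icc (0 : ℝ) Dplus) ∪ {z t}) (Or.inr rfl)
      exact convex_convexHull ℝ _ hzt
        (subset_convexHull ℝ _ (Or.inl ⟨zstar.2, ⟨hr0, hrD.trans hDplus⟩, rfl⟩))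
        (by linarith) hγ0 (by ring)
    have hwr : w.2 = (1 - γ) * r + γ * zstar.2 := rfl
    have hw1 : w.1 = (1 - γ) • x + γ • (zstar.2 • o) := rfl
    have hwK : w.1 ∈ K := hKconv hx hoK (by linarith) hγ0 (by ring)
    have hdir : w.1 - x = γ • (zstar.2 • o - x) := by
      rw [hw1]
      module
    have hsm := hsmooth x hx w.1 hwK
    rw [hdir, hnhom, abs_of_nonneg hγ0, inner_smul_right, inner_sub_right, mul_pow] at hsm
    have hnorm : nE (zstar.2 • o - x) ≤ zstar.2 + r := by
      have h := hntri (zstar.2 • o) ((-1 : ℝ) • x)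
      rw [hnhom, hnhom, neg_one_smul, ← sub_eq_add_neg, abs_of_nonneg hr0, abs_neg, abs_one,
        one_mul] at h
      linarith [mul_le_of_le_one_right hr0 (hor1 (f' x))]
    have hsq : Lf / 2 * (γ ^ 2 * nE (zstar.2 • o - x) ^ 2)
        ≤ Lf / 2 * (γ ^ 2 * (zstar.2 + r) ^ 2) := by
      gcongr
      exact hnn _
    have hgrad := hconv.add_inner_le_of_hasGradientAt (hdiff x) hx hxK
    rw [inner_sub_right] at hgrad
    have hlin := inner_smul_le_of_isMinOn_cone hn0 hnn hnhom hKcone (hormin (f' x)) hxK hxr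
    have hγ := mul_le_mul_of_nonneg_left
      (show ⟪f' x, zstar.2 • o⟫ - ⟪f' x, x⟫ ≤ f zstar.1 - f x by linarith) hγ0
    rw [hF w, hwr] at hw
    rw [hF (z t), hF zstar]
    linarith
  refine ⟨hmem, hmono, fun t ht => ?_⟩
  induction t, ht using Nat.le_induction with
  | base =>
    have h := hstep 1 le_rfl 1 zero_le_one le_rfl
    rw [hz1] at h
    have hsq : Lf / 2 * zstar.2 ^ 2 ≤ Lf / 2 * Dstar ^ 2 := by gcongr
    norm_num at h ⊢
    linarith
  | succ t ht ih =>
    have ht1 : 1 ≤ t := by lia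
    have hn : (0 : ℝ) < (t : ℝ) + 14 := by positivity
    have hγ1 : 2 / ((t : ℝ) + 14) ≤ 1 := by
      rw [div_le_one hn]
      have : (0 : ℝ) ≤ t := t.cast_nonneg
      linarith
    have h := hstep t ht1 (2 / ((t : ℝ) + 14)) (by positivity) hγ1
    have hr : 0 ≤ (z t).2 := (hnn _).trans (hmem t ht1).2
    have hsum : zstar.2 + (z t).2 ≤ 2 * Dstar := by linarith [hradius t ht1]
    calc F (z (t + 1)) - F zstar
        ≤ (1 - 2 / ((t : ℝ) + 14)) * (8 * Lf * Dstar ^ 2 / ((t : ℝ) + 14))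
          + Lf / 2 * (2 / ((t : ℝ) + 14)) ^ 2 * (2 * Dstar) ^ 2 := by
          refine h.trans ?_
          gcongr
      _ = 8 * Lf * Dstar ^ 2 * (((t : ℝ) + 13) / ((t : ℝ) + 14) ^ 2) := by
          field_simp
          ring
      _ ≤ 8 * Lf * Dstar ^ 2 * (1 / ((t : ℝ) + 1 + 14)) := by
          refine mul_le_mul_of_nonneg_left ?_ (by positivity)
          rw [div_le_div_iff₀ (by positivity) (by positivity)]
          nlinarith
      _ = 8 * Lf * Dstar ^ 2 / (((t + 1 : ℕ) : ℝ) + 14) := by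
          push_cast
          ring
end

section
/- For every nonzero zero-mean image η ∈ M_0^n, the quantity s_* = sup{s ≥ 0 : there exists a vector field (g, h) with ‖(g,h)‖_∞ ≤ 1 and G*(g,h) = s·η} is finite, attained, and positive, and it satisfies s_* · max{⟨η, x⟩ : x ∈ M_0^n, TV(x) ≤ 1} = 1. In particular, −z̄/TV(z̄) minimizes ⟨η, ·⟩ over {x ∈ M_0^n : TV(x) ≤ 1} whenever z̄ is a zero-mean image with ⟨z̄, η⟩ = 1 and TV(z̄) = s_*. -/
/-- The (anisotropic) total variation of an `(n+2) × (n+2)` image. -/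
def imgTV (n : ℕ) (x : Fin (n + 2) → Fin (n + 2) → ℝ) : ℝ :=
  (∑ i : Fin (n + 1), ∑ j : Fin (n + 2), |x i.succ j - x i.castSucc j|) +
  (∑ i : Fin (n + 2), ∑ j : Fin (n + 1), |x i j.succ - x i j.castSucc|)

/-- The inner product `⟨x, y⟩ = ∑_{i,j} x(i,j) y(i,j)` of two images. -/
def imgInner (n : ℕ) (x y : Fin (n + 2) → Fin (n + 2) → ℝ) : ℝ :=
  ∑ i : Fin (n + 2), ∑ j : Fin (n + 2), x i j * y i j

/-- `(g, h)` is a discrete vector field with `G*(g,h) = s·η`, expressed through the defining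
adjointness identity `⟨(g,h), G x⟩ = s ⟨η, x⟩` for all images `x`. -/
def isScaledAdjointImage (n : ℕ) (g : Fin (n + 1) → Fin (n + 2) → ℝ)
    (h : Fin (n + 2) → Fin (n + 1) → ℝ) (s : ℝ) (η : Fin (n + 2) → Fin (n + 2) → ℝ) : Prop :=
  ∀ x : Fin (n + 2) → Fin (n + 2) → ℝ,
    (∑ i : Fin (n + 1), ∑ j : Fin (n + 2), g i j * (x i.succ j - x i.castSucc j)) +
    (∑ i : Fin (n + 2), ∑ j : Fin (n + 1), h i j * (x i j.succ - x i j.castSucc)) =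
    s * imgInner n η x

/-- A linear functional dominated by the `ℓ¹`-norm of a linear map `G` factors through `G` by a
vector of sup-norm at most one. -/
theorem exists_bounded_dual_of_le_sum_abs {E ι : Type*} [AddCommGroup E] [Module ℝ E] [Fintype ι]
    (G : E →ₗ[ℝ] (ι → ℝ)) (φ : E →ₗ[ℝ] ℝ) (hφ : ∀ x, φ x ≤ ∑ i, |G x i|) :
    ∃ w : ι → ℝ, (∀ i, |w i| ≤ 1) ∧ ∀ x, ∑ i, w i * G x i = φ x := by
  classical
  have hker : φ ∈ G.ker.dualAnnihilator := by
    rw [Submodule.mem_dualAnnihilator]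
    intro x hx
    rw [LinearMap.mem_ker] at hx
    have h₁ := hφ x
    have h₂ := hφ (-x)
    simp only [map_neg, hx, Pi.zero_apply, neg_zero, abs_zero, Finset.sum_const_zero] at h₁ h₂
    linarith
  rw [← LinearMap.range_dualMap_eq_dualAnnihilator_ker] at hker
  obtain ⟨ψ, rfl⟩ := hker
  obtain ⟨Ψ, hext, hle⟩ := exists_extension_of_le_sublinear
    (⟨G.range, ψ.comp G.range.subtype⟩ : (ι → ℝ) →ₗ.[ℝ] ℝ) (fun y => ∑ i, |y i|)
    (fun c hc y => by simp [abs_mul, abs_of_pos hc, Finset.mul_sum])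
    (fun y z => by
      rw [← Finset.sum_add_distrib]
      exact Finset.sum_le_sum fun i _ => abs_add_le _ _)
    (by rintro ⟨_, x, rfl⟩; exact hφ x)
  refine ⟨fun i => Ψ (Pi.single i 1), fun i => ?_, fun x => ?_⟩
  · have hsum : ∑ k, |(Pi.single i (1 : ℝ) : ι → ℝ) k| = 1 := by
      rw [Finset.sum_eq_single i] <;> simp +contextual
    have h₁ := hle (Pi.single i 1)
    have h₂ := hle (-Pi.single i 1)
    simp only [Pi.neg_apply, abs_neg, hsum, map_neg] at h₁ h₂
    exact abs_le.2 ⟨by linarith, h₁⟩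
  · have h := hext ⟨G x, x, rfl⟩
    simp only [LinearPMap.mk_apply] at h
    change Ψ (G x) = ψ (G x) at h
    rw [LinearMap.dualMap_apply, ← h, LinearMap.pi_apply_eq_sum_univ Ψ (G x)]
    refine Finset.sum_congr rfl fun i _ => ?_
    have hsingle : (Pi.single i (1 : ℝ) : ι → ℝ) = fun k => if i = k then 1 else 0 := by
      ext k
      simp [Pi.single_apply, eq_comm]
    rw [smul_eq_mul, mul_comm, ← hsingle]

theorem abs_sub_zero_le_sum_abs_sub {m : ℕ} (f : Fin (m + 1) → ℝ) (i : Fin (m + 1)) :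
    |f i - f 0| ≤ ∑ k : Fin m, |f k.succ - f k.castSucc| := by
  induction m with
  | zero => simp [Fin.fin_one_eq_zero i]
  | succ m ih =>
    rw [Fin.sum_univ_castSucc]
    have h := ih (fun k => f k.castSucc)
    refine Fin.lastCases ?_ (fun k => ?_) i
    · have h₁ := h (Fin.last m)
      simp only [Fin.castSucc_zero, ← Fin.succ_castSucc] at h₁
      have h₂ := abs_sub_le (f (Fin.last (m + 1))) (f (Fin.last m).castSucc) (f 0)
      rw [Fin.succ_last]
      linarith
    · have h₁ := h k
      simp only [Fin.castSucc_zero, ← Fin.succ_castSucc] at h₁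
      exact h₁.trans (le_add_of_nonneg_right (abs_nonneg _))

/-- The discrete gradient of an image, as a linear map. -/
def imgGrad (n : ℕ) : (Fin (n + 2) → Fin (n + 2) → ℝ) →ₗ[ℝ]
    ((Fin (n + 1) × Fin (n + 2)) ⊕ (Fin (n + 2) × Fin (n + 1)) → ℝ) where
  toFun x := Sum.elim (fun p => x p.1.succ p.2 - x p.1.castSucc p.2)
    (fun p => x p.1 p.2.succ - x p.1 p.2.castSucc)
  map_add' x y := by ext (p | p) <;> simp <;> ring
  map_smul' c x := by ext (p | p) <;> simp <;> ring

/-- The inner product with a fixed image, as a linear functional. -/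
def imgInnerLeft (n : ℕ) (η : Fin (n + 2) → Fin (n + 2) → ℝ) :
    (Fin (n + 2) → Fin (n + 2) → ℝ) →ₗ[ℝ] ℝ where
  toFun := imgInner n η
  map_add' x y := by simp [imgInner, mul_add, Finset.sum_add_distrib]
  map_smul' c x := by simp [imgInner, Finset.mul_sum, mul_left_comm]

theorem imgTV_eq_sum_abs_imgGrad (n : ℕ) (x : Fin (n + 2) → Fin (n + 2) → ℝ) :
    imgTV n x = ∑ p, |imgGrad n x p| := by
  simp [imgTV, imgGrad, Fintype.sum_sum_type, Fintype.sum_prod_type]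

theorem imgTV_nonneg (n : ℕ) (x : Fin (n + 2) → Fin (n + 2) → ℝ) : 0 ≤ imgTV n x := by
  rw [imgTV_eq_sum_abs_imgGrad]
  positivity

theorem imgTV_smul (n : ℕ) (c : ℝ) (x : Fin (n + 2) → Fin (n + 2) → ℝ) :
    imgTV n (c • x) = |c| * imgTV n x := by
  simp only [imgTV_eq_sum_abs_imgGrad, map_smul, Pi.smul_apply, smul_eq_mul, abs_mul,
    Finset.mul_sum]

theorem continuous_imgTV (n : ℕ) : Continuous (imgTV n) := by
  unfold imgTV
  fun_prop

theorem imgInner_comm (n : ℕ) (x y : Fin (n + 2) → Fin (n + 2) → ℝ) :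
    imgInner n x y = imgInner n y x := by
  simp [imgInner, mul_comm]

theorem imgInner_smul_right (n : ℕ) (c : ℝ) (x y : Fin (n + 2) → Fin (n + 2) → ℝ) :
    imgInner n x (c • y) = c * imgInner n x y :=
  (imgInnerLeft n x).map_smul c y

theorem continuous_imgInner (n : ℕ) (η : Fin (n + 2) → Fin (n + 2) → ℝ) :
    Continuous (imgInner n η) := by
  unfold imgInner
  fun_prop

theorem sum_smul_eq_zero {n : ℕ} {x : Fin (n + 2) → Fin (n + 2) → ℝ}
    (hx : ∑ i, ∑ j, x i j = 0) (c : ℝ) : ∑ i, ∑ j, (c • x) i j = 0 := by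
  simp [← Finset.mul_sum, hx]

theorem abs_sub_corner_le_imgTV (n : ℕ) (x : Fin (n + 2) → Fin (n + 2) → ℝ)
    (i j : Fin (n + 2)) : |x i j - x 0 0| ≤ imgTV n x := by
  have h₁ := abs_sub_zero_le_sum_abs_sub (fun k => x k j) i
  have h₂ := abs_sub_zero_le_sum_abs_sub (x 0) j
  have h₃ : ∑ k : Fin (n + 1), |x k.succ j - x k.castSucc j| ≤
      ∑ k : Fin (n + 1), ∑ l : Fin (n + 2), |x k.succ l - x k.castSucc l| :=
    Finset.sum_le_sum fun k _ => Finset.single_le_sum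
      (f := fun l => |x k.succ l - x k.castSucc l|) (fun _ _ => abs_nonneg _) (Finset.mem_univ j)
  have h₄ : ∑ l : Fin (n + 1), |x 0 l.succ - x 0 l.castSucc| ≤
      ∑ k : Fin (n + 2), ∑ l : Fin (n + 1), |x k l.succ - x k l.castSucc| :=
    Finset.single_le_sum (f := fun k => ∑ l : Fin (n + 1), |x k l.succ - x k l.castSucc|)
      (fun _ _ => Finset.sum_nonneg fun _ _ => abs_nonneg _) (Finset.mem_univ 0)
  have h₅ := abs_sub_le (x i j) (x 0 j) (x 0 0)
  unfold imgTV
  linarith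

theorem abs_le_two_mul_imgTV {n : ℕ} {x : Fin (n + 2) → Fin (n + 2) → ℝ}
    (hx : ∑ i, ∑ j, x i j = 0) (i j : Fin (n + 2)) : |x i j| ≤ 2 * imgTV n x := by
  have hcorner : |x 0 0| ≤ imgTV n x := by
    have hub : ∑ i, ∑ j, (x i j - x 0 0) ≤ ∑ _i : Fin (n + 2), ∑ _j : Fin (n + 2), imgTV n x :=
      Finset.sum_le_sum fun i _ => Finset.sum_le_sum fun j _ =>
        (abs_le.1 (abs_sub_corner_le_imgTV n x i j)).2
    have hlb : ∑ _i : Fin (n + 2), ∑ _j : Fin (n + 2), -imgTV n x ≤ ∑ i, ∑ j, (x i j - x 0 0) :=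
      Finset.sum_le_sum fun i _ => Finset.sum_le_sum fun j _ =>
        (abs_le.1 (abs_sub_corner_le_imgTV n x i j)).1
    simp only [Finset.sum_sub_distrib, hx, Finset.sum_const, Finset.card_univ, Fintype.card_fin,
      nsmul_eq_mul, zero_sub] at hub hlb
    have hN : (0 : ℝ) < ((n + 2 : ℕ) : ℝ) := by positivity
    rw [← mul_neg, ← mul_neg, mul_le_mul_iff_right₀ hN, mul_le_mul_iff_right₀ hN] at hub
    rw [← mul_neg, ← mul_neg, mul_le_mul_iff_right₀ hN, mul_le_mul_iff_right₀ hN] at hlb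
    exact abs_le.2 ⟨by linarith, by linarith⟩
  have h₁ := abs_sub_corner_le_imgTV n x i j
  have h₂ := abs_sub_abs_le_abs_sub (x i j) (x 0 0)
  linarith

theorem isCompact_zero_mean_imgTV_le_one (n : ℕ) :
    IsCompact {x : Fin (n + 2) → Fin (n + 2) → ℝ | (∑ i, ∑ j, x i j = 0) ∧ imgTV n x ≤ 1} := by
  refine Metric.isCompact_of_isClosed_isBounded ?_ ?_
  · exact (isClosed_eq (by fun_prop) continuous_const).inter
      (isClosed_le (continuous_imgTV n) continuous_const)
  · refine isBounded_iff_forall_norm_le.2 ⟨2, fun x hx => ?_⟩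
    refine (pi_norm_le_iff_of_nonneg (by norm_num)).2 fun i =>
      (pi_norm_le_iff_of_nonneg (by norm_num)).2 fun j => ?_
    have h := abs_le_two_mul_imgTV hx.1 i j
    have h₁ := hx.2
    rw [Real.norm_eq_abs]
    linarith

theorem eq_zero_of_imgTV_eq_zero {n : ℕ} {x : Fin (n + 2) → Fin (n + 2) → ℝ}
    (hx : ∑ i, ∑ j, x i j = 0) (hTV : imgTV n x = 0) : x = 0 := by
  ext i j
  have h := abs_le_two_mul_imgTV hx i j
  rw [hTV, mul_zero] at h
  exact abs_nonpos_iff.1 h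

theorem imgInner_self_pos {n : ℕ} {η : Fin (n + 2) → Fin (n + 2) → ℝ} (hη : η ≠ 0) :
    0 < imgInner n η η := by
  have hnonneg : ∀ i, 0 ≤ ∑ j, η i j * η i j := fun i =>
    Finset.sum_nonneg fun j _ => mul_self_nonneg _
  refine lt_of_le_of_ne (Finset.sum_nonneg fun i _ => hnonneg i) fun h => hη ?_
  ext i j
  have hrow := (Finset.sum_eq_zero_iff_of_nonneg fun i _ => hnonneg i).1 h.symm i
    (Finset.mem_univ i)
  exact mul_self_eq_zero.1 ((Finset.sum_eq_zero_iff_of_nonneg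
    fun j _ => mul_self_nonneg (η i j)).1 hrow j (Finset.mem_univ j))

/-- A bound for `⟨η, ·⟩` on the zero-mean total variation unit ball bounds it by a multiple of the
total variation on all images. -/
theorem imgInner_le_mul_imgTV {n : ℕ} {η : Fin (n + 2) → Fin (n + 2) → ℝ}
    (hη : ∑ i, ∑ j, η i j = 0) {v : ℝ}
    (hv : ∀ x : Fin (n + 2) → Fin (n + 2) → ℝ, (∑ i, ∑ j, x i j = 0) → imgTV n x ≤ 1 →
      imgInner n η x ≤ v) (x : Fin (n + 2) → Fin (n + 2) → ℝ) :
    imgInner n η x ≤ v * imgTV n x := by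
  set m : ℝ := (∑ i, ∑ j, x i j) / ((n + 2 : ℕ) * (n + 2 : ℕ) : ℝ) with hm
  set y : Fin (n + 2) → Fin (n + 2) → ℝ := fun i j => x i j - m with hy
  have hy0 : ∑ i, ∑ j, y i j = 0 := by
    simp only [hy, Finset.sum_sub_distrib, Finset.sum_const, Finset.card_univ, Fintype.card_fin,
      nsmul_eq_mul, hm]
    field_simp
    ring
  have hTV : imgTV n y = imgTV n x := by simp [imgTV, hy]
  have hinner : imgInner n η y = imgInner n η x := by
    simp [imgInner, hy, mul_sub, Finset.sum_sub_distrib, ← Finset.sum_mul, hη]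
  rw [← hTV, ← hinner]
  rcases (imgTV_nonneg n y).eq_or_lt with h | h
  · rw [← h, eq_zero_of_imgTV_eq_zero hy0 h.symm]
    simp [imgInner]
  · have hb := hv ((imgTV n y)⁻¹ • y) (sum_smul_eq_zero hy0 _)
      (by rw [imgTV_smul, abs_of_pos (inv_pos.2 h), inv_mul_cancel₀ h.ne'])
    rw [imgInner_smul_right, inv_mul_le_iff₀ h] at hb
    linarith

/-- For every nonzero zero-mean image `η`, the quantity
`s_* = sup{s ≥ 0 : ∃ (g,h), ‖(g,h)‖_∞ ≤ 1, G*(g,h) = s·η}` is finite, attained and positive,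
and `s_* · max{⟨η, x⟩ : x zero-mean, TV(x) ≤ 1} = 1`.  In particular, `−z̄/TV(z̄)` minimizes
`⟨η, ·⟩` over the zero-mean TV unit ball whenever `z̄` is zero-mean with `⟨z̄, η⟩ = 1` and
`TV(z̄) = s_*`.  (The side length `n ≥ 2` is written as `n + 2` with `n : ℕ`.) -/
theorem tv_lo_oracle_duality (n : ℕ) (η : Fin (n + 2) → Fin (n + 2) → ℝ)
    (hη0 : ∑ i, ∑ j, η i j = 0) (hηne : η ≠ 0) :
    ∃ sstar : ℝ,
      IsGreatest {s : ℝ | 0 ≤ s ∧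
          ∃ (g : Fin (n + 1) → Fin (n + 2) → ℝ) (h : Fin (n + 2) → Fin (n + 1) → ℝ),
            (∀ i j, |g i j| ≤ 1) ∧ (∀ i j, |h i j| ≤ 1) ∧
            isScaledAdjointImage n g h s η} sstar ∧
      0 < sstar ∧
      (∃ vmax : ℝ,
        IsGreatest {v : ℝ | ∃ x : Fin (n + 2) → Fin (n + 2) → ℝ,
            (∑ i, ∑ j, x i j = 0) ∧ imgTV n x ≤ 1 ∧ v = imgInner n η x} vmax ∧
        sstar * vmax = 1) ∧
      (∀ zbar : Fin (n + 2) → Fin (n + 2) → ℝ,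
        (∑ i, ∑ j, zbar i j = 0) → imgInner n zbar η = 1 → imgTV n zbar = sstar →
        (∑ i, ∑ j, (-(imgTV n zbar)⁻¹ • zbar) i j = 0) ∧
        imgTV n (-(imgTV n zbar)⁻¹ • zbar) ≤ 1 ∧
        ∀ x : Fin (n + 2) → Fin (n + 2) → ℝ,
          (∑ i, ∑ j, x i j = 0) → imgTV n x ≤ 1 →
          imgInner n η (-(imgTV n zbar)⁻¹ • zbar) ≤ imgInner n η x) := by
  obtain ⟨x₀, hx₀, hmax⟩ := (isCompact_zero_mean_imgTV_le_one n).exists_isMaxOn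
    ⟨0, by simp, by simp [imgTV]⟩ (continuous_imgInner n η).continuousOn
  set v := imgInner n η x₀ with hv
  have hle : ∀ x : Fin (n + 2) → Fin (n + 2) → ℝ, (∑ i, ∑ j, x i j = 0) → imgTV n x ≤ 1 →
      imgInner n η x ≤ v := fun x h₁ h₂ => hmax ⟨h₁, h₂⟩
  have hbound := imgInner_le_mul_imgTV hη0 hle
  have hvpos : 0 < v :=
    pos_of_mul_pos_left ((imgInner_self_pos hηne).trans_le (hbound η)) (imgTV_nonneg n η)
  refine ⟨v⁻¹, ⟨⟨inv_nonneg.2 hvpos.le, ?_⟩, ?_⟩, inv_pos.2 hvpos,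
    ⟨v, ⟨⟨x₀, hx₀.1, hx₀.2, rfl⟩, ?_⟩, inv_mul_cancel₀ hvpos.ne'⟩, ?_⟩
  · obtain ⟨w, hw, hwG⟩ := exists_bounded_dual_of_le_sum_abs (imgGrad n)
      (v⁻¹ • imgInnerLeft n η) fun x => by
        rw [← imgTV_eq_sum_abs_imgGrad]
        exact (inv_mul_le_iff₀ hvpos).2 (hbound x)
    refine ⟨fun i j => w (Sum.inl (i, j)), fun i j => w (Sum.inr (i, j)), fun i j => hw _,
      fun i j => hw _, fun x => ?_⟩
    have h := hwG x
    rw [Fintype.sum_sum_type, Fintype.sum_prod_type, Fintype.sum_prod_type] at h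
    exact h
  · rintro s ⟨-, g, h, hg, hh, hs⟩
    have hmul : ∀ {a b : ℝ}, |a| ≤ 1 → a * b ≤ |b| := fun {a b} ha =>
      (le_abs_self _).trans (by
        rw [abs_mul]; exact mul_le_of_le_one_left (abs_nonneg b) ha)
    have hTV : s * v ≤ imgTV n x₀ := by
      rw [hv, ← hs x₀]
      exact add_le_add
        (Finset.sum_le_sum fun i _ => Finset.sum_le_sum fun j _ => hmul (hg i j))
        (Finset.sum_le_sum fun i _ => Finset.sum_le_sum fun j _ => hmul (hh i j))
    rw [← one_div, le_div_iff₀ hvpos]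
    exact hTV.trans hx₀.2
  · rintro _ ⟨x, h₁, h₂, rfl⟩
    exact hle x h₁ h₂
  · intro z hz hzη hzTV
    refine ⟨sum_smul_eq_zero hz _, ?_, fun x h₁ h₂ => ?_⟩
    · rw [imgTV_smul, hzTV, abs_neg, inv_inv, abs_of_pos hvpos, mul_inv_cancel₀ hvpos.ne']
    · rw [imgInner_smul_right, imgInner_comm n η z, hzη, hzTV, inv_inv]
      have h := hle ((-1 : ℝ) • x) (sum_smul_eq_zero h₁ _) (by
        rwa [imgTV_smul, abs_neg, abs_one, one_mul])
      rw [imgInner_smul_right] at h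
      linarith
end

section
/- There exists an absolute constant C > 0 such that for every integer n ≥ 2 and every zero-mean image x ∈ M_0^n with TV(x) ≤ 1, one has ‖x‖₂ ≤ C √(ln n). Equivalently, Q_n := max{‖x‖₂ : x ∈ M_0^n, TV(x) ≤ 1} satisfies Q_n ≤ C √(ln n). -/
theorem abs_sub_le_sum_abs_succ_sub {m : ℕ} (f : Fin (m + 1) → ℝ) (a b : Fin (m + 1)) :
    |f a - f b| ≤ ∑ i : Fin m, |f i.succ - f i.castSucc| := by
  induction m with
  | zero => simp [Fin.fin_one_eq_zero]
  | succ m ih =>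
    have key : ∀ c : Fin (m + 1), |f (Fin.last _) - f c.castSucc| ≤
        ∑ i : Fin (m + 1), |f i.succ - f i.castSucc| := fun c => by
      rw [Fin.sum_univ_castSucc, add_comm (∑ _, _)]
      exact (abs_sub_le _ (f (Fin.last m).castSucc) _).trans
        (add_le_add le_rfl (ih (fun i => f i.castSucc) (Fin.last m) c))
    induction a using Fin.lastCases with
    | last =>
      induction b using Fin.lastCases with
      | last => simpa using Finset.sum_nonneg fun i _ => abs_nonneg (f i.succ - f i.castSucc)
      | cast b => exact key b
    | cast a =>
      induction b using Fin.lastCases with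
      | last => rw [abs_sub_comm]; exact key a
      | cast b =>
        rw [Fin.sum_univ_castSucc]
        exact (ih (fun i => f i.castSucc) a b).trans (le_add_of_nonneg_right (abs_nonneg _))

/-- For a function of zero sum, the squared differences sum to twice the cardinality times the
sum of squares. -/
theorem sum_sum_sub_sq_of_sum_eq_zero {ι : Type*} [Fintype ι] (f : ι → ℝ) (h : ∑ p, f p = 0) :
    ∑ p, ∑ q, (f p - f q) ^ 2 = 2 * Fintype.card ι * ∑ p, f p ^ 2 := by
  simp only [sub_sq, Finset.sum_add_distrib, Finset.sum_sub_distrib, ← Finset.mul_sum, h,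
    mul_zero, Finset.sum_const, Finset.card_univ, nsmul_eq_mul]
  ring

/-- A discrete Gagliardo–Nirenberg–Sobolev inequality: if the oscillation of a zero-sum array along
column `j` is at most `A j` and along row `i` at most `B i`, then its `ℓ²` norm is controlled by
`∑ A + ∑ B`. -/
theorem two_mul_sum_sq_le_of_oscillation_le {ι : Type*} [Fintype ι] [Nonempty ι]
    (x : ι → ι → ℝ) (A B : ι → ℝ) (h : ∑ i, ∑ j, x i j = 0)
    (hA : ∀ i k j, |x i j - x k j| ≤ A j) (hB : ∀ i j l, |x i j - x i l| ≤ B i) :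
    2 * ∑ i, ∑ j, x i j ^ 2 ≤ (∑ j, A j + ∑ i, B i) ^ 2 := by
  have hcard : (0 : ℝ) < Fintype.card ι := by exact_mod_cast Fintype.card_pos
  have hpt : ∀ i j k l, (x i j - x k l) ^ 2 ≤ (A j + B k) * (B i + A l) := fun i j k l => by
    rw [← sq_abs, sq]
    have h₁ := (abs_sub_le (x i j) (x k j) (x k l)).trans (add_le_add (hA i k j) (hB k j l))
    have h₂ := (abs_sub_le (x i j) (x i l) (x k l)).trans (add_le_add (hB i j l) (hA i k l))
    exact mul_le_mul h₁ h₂ (abs_nonneg _) ((abs_nonneg _).trans h₁)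
  have hsum : ∑ i, ∑ j, ∑ k, ∑ l, (x i j - x k l) ^ 2 ≤
      ∑ i, ∑ j, ∑ k, ∑ l, (A j + B k) * (B i + A l) := by
    gcongr with i _ j _ k _ l _
    exact hpt i j k l
  have hleft := sum_sum_sub_sq_of_sum_eq_zero (fun p : ι × ι => x p.1 p.2)
    (by simpa only [Fintype.sum_prod_type] using h)
  simp only [Fintype.sum_prod_type, Fintype.card_prod, Nat.cast_mul] at hleft
  have hright : ∑ i, ∑ j, ∑ k, ∑ l, (A j + B k) * (B i + A l) =
      (Fintype.card ι : ℝ) ^ 2 * (∑ j, A j + ∑ i, B i) ^ 2 := by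
    simp only [← Finset.mul_sum, ← Finset.sum_mul, Finset.sum_add_distrib, Finset.sum_const,
      Finset.card_univ, nsmul_eq_mul]
    ring
  rw [hleft, hright] at hsum
  refine le_of_mul_le_mul_left ?_ (pow_pos hcard 2)
  linarith

/-- There exists an absolute constant `C > 0` such that for every integer
`n ≥ 2` and every zero-mean `n × n` image `x` with `TV(x) ≤ 1`, one has `‖x‖₂ ≤ C √(ln n)`
(here the side length is written as `n + 2` so that `n` ranges over all naturals). -/
theorem tv_l2_log_bound :
    ∃ C : ℝ, 0 < C ∧
      ∀ (n : ℕ) (x : Fin (n + 2) → Fin (n + 2) → ℝ),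
        (∑ i, ∑ j, x i j = 0) → imgTV n x ≤ 1 →
        Real.sqrt (∑ i, ∑ j, (x i j) ^ 2) ≤ C * Real.sqrt (Real.log (n + 2)) := by
  refine ⟨1, one_pos, fun n x h hTV => ?_⟩
  rw [one_mul]
  apply Real.sqrt_le_sqrt
  have hnonneg : 0 ≤ imgTV n x := by unfold imgTV; positivity
  have hsob := two_mul_sum_sq_le_of_oscillation_le x
    (fun j => ∑ i : Fin (n + 1), |x i.succ j - x i.castSucc j|)
    (fun i => ∑ j : Fin (n + 1), |x i j.succ - x i j.castSucc|) h
    (fun i k j => abs_sub_le_sum_abs_succ_sub (fun i => x i j) i k)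
    (fun i j l => abs_sub_le_sum_abs_succ_sub (x i) j l)
  rw [Finset.sum_comm (f := fun j (i : Fin (n + 1)) => |x i.succ j - x i.castSucc j|),
    ← imgTV] at hsob
  have hlog : Real.log 2 ≤ Real.log (n + 2) :=
    Real.log_le_log two_pos (le_add_of_nonneg_left n.cast_nonneg)
  linarith [pow_le_one₀ (n := 2) hnonneg hTV, Real.log_two_gt_d9]
end

section
/- Let L > 0, γ_k = 2/(k+1), and let (ε_k)_{k≥1} and (Δ_k)_{k≥1} be sequences of nonnegative reals satisfying, for all k ≥ 1, ε_{k+1} ≤ (1 − γ_k) ε_k + (L/2) γ_k² and γ_k Δ_k ≤ ε_k − ε_{k+1} + (L/2) γ_k². Then for every t ≥ 5, min_{1≤k≤t} Δ_k ≤ 4.5 L/(t − 2). -/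
/-- The classical `2L/k` rate of the recursion with step sizes `2/(k+1)`. -/
theorem le_two_mul_div_of_recurrence {L : ℝ} (hL : 0 < L) {ε : ℕ → ℝ}
    (hrec : ∀ k : ℕ, 1 ≤ k →
      ε (k + 1) ≤ (1 - 2 / ((k : ℝ) + 1)) * ε k + L / 2 * (2 / ((k : ℝ) + 1)) ^ 2)
    (k : ℕ) (hk : 2 ≤ k) : ε k ≤ 2 * L / k := by
  induction k, hk using Nat.le_induction with
  | base =>
    have h := hrec 1 le_rfl
    norm_num at h ⊢
    linarith
  | succ k hk ih =>
    have h := hrec k (by omega)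
    have hk' : (2 : ℝ) ≤ k := by exact_mod_cast hk
    have hpos : 0 ≤ 1 - 2 / ((k : ℝ) + 1) := by
      rw [sub_nonneg, div_le_one (by linarith)]
      linarith
    have hmul := mul_le_mul_of_nonneg_left ih hpos
    have hid : 2 * L / ((k : ℝ) + 1) - ((1 - 2 / ((k : ℝ) + 1)) * (2 * L / k)
        + L / 2 * (2 / ((k : ℝ) + 1)) ^ 2) = 2 * L / (k * ((k : ℝ) + 1) ^ 2) := by
      field_simp
      ring
    have hrest : 0 ≤ 2 * L / (k * ((k : ℝ) + 1) ^ 2) := by positivity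
    push_cast
    linarith

/-- Telescoping the gap inequality, with `1/(k+1)` bounded below by its tangent at `c`. -/
theorem mul_tangent_sum_le_of_gap {L D : ℝ} (hL : 0 < L) (hD : 0 ≤ D) {ε Δ : ℕ → ℝ}
    (hgap : ∀ k : ℕ, 1 ≤ k →
      2 / ((k : ℝ) + 1) * Δ k ≤ ε k - ε (k + 1) + L / 2 * (2 / ((k : ℝ) + 1)) ^ 2)
    {t : ℕ} (hDle : ∀ k : ℕ, 1 ≤ k → k ≤ t → D ≤ Δ k) {m : ℕ} (hm : 1 ≤ m)
    {c : ℝ} (hc : 0 < c) (n : ℕ) (hn : m + n ≤ t + 1) :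
    2 * D * (2 * n / c - n * (m + 1 + ((n : ℝ) - 1) / 2) / c ^ 2)
      ≤ ε m - ε (m + n) + 2 * L * (1 / m - 1 / ((m : ℝ) + n)) := by
  induction n with
  | zero => simp
  | succ n ih =>
    have h := hgap (m + n) (by omega)
    have hDk := hDle (m + n) (by omega) (by omega)
    have ih := ih (by omega)
    have hm' : (1 : ℝ) ≤ m := by exact_mod_cast hm
    have hn' : (0 : ℝ) ≤ n := n.cast_nonneg
    have hx : 0 < (m : ℝ) + n := by linarith
    push_cast at h ⊢
    rw [← add_assoc m n 1, ← add_assoc (m : ℝ) n 1]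
    generalize hxdef : (m : ℝ) + n = x at *
    have htan : 2 / c - (x + 1) / c ^ 2 ≤ 1 / (x + 1) := by
      have hid : 1 / (x + 1) - (2 / c - (x + 1) / c ^ 2)
          = (x + 1 - c) ^ 2 / ((x + 1) * c ^ 2) := by
        field_simp
        ring
      have hrest : 0 ≤ (x + 1 - c) ^ 2 / ((x + 1) * c ^ 2) := by positivity
      linarith
    have hsq : L / 2 * (2 / (x + 1)) ^ 2 ≤ 2 * L * (1 / x - 1 / (x + 1)) := by
      have hid : 2 * L * (1 / x - 1 / (x + 1)) - L / 2 * (2 / (x + 1)) ^ 2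
          = 2 * L / (x * (x + 1) ^ 2) := by
        field_simp
        ring
      have hrest : 0 ≤ 2 * L / (x * (x + 1) ^ 2) := by positivity
      linarith
    have hstep : 2 * D * (2 / c - (x + 1) / c ^ 2) ≤ 2 / (x + 1) * Δ (m + n) :=
      calc 2 * D * (2 / c - (x + 1) / c ^ 2) ≤ 2 * D * (1 / (x + 1)) := by gcongr
        _ = 2 / (x + 1) * D := by ring
        _ ≤ 2 / (x + 1) * Δ (m + n) := by gcongr
    have hsum : 2 * D * (2 * ((n : ℝ) + 1) / c
          - (n + 1) * (m + 1 + ((n : ℝ) + 1 - 1) / 2) / c ^ 2)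
        = 2 * D * (2 * n / c - n * (m + 1 + ((n : ℝ) - 1) / 2) / c ^ 2)
          + 2 * D * (2 / c - (x + 1) / c ^ 2) := by
      rw [← hxdef]
      ring
    rw [hsum]
    linarith

/-- The bound on a common lower bound `D` of the gaps obtained from the indices `m, …, t`. -/
theorem le_of_gap_recurrence {L D : ℝ} (hL : 0 < L) (hD : 0 ≤ D) {ε Δ : ℕ → ℝ}
    (hεpos : ∀ k : ℕ, 1 ≤ k → 0 ≤ ε k)
    (hrec : ∀ k : ℕ, 1 ≤ k →
      ε (k + 1) ≤ (1 - 2 / ((k : ℝ) + 1)) * ε k + L / 2 * (2 / ((k : ℝ) + 1)) ^ 2)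
    (hgap : ∀ k : ℕ, 1 ≤ k →
      2 / ((k : ℝ) + 1) * Δ k ≤ ε k - ε (k + 1) + L / 2 * (2 / ((k : ℝ) + 1)) ^ 2)
    {t : ℕ} (hDle : ∀ k : ℕ, 1 ≤ k → k ≤ t → D ≤ Δ k) {m n : ℕ} (hm : 2 ≤ m)
    (hn : 1 ≤ n) (hmn : m + n = t + 1) :
    D ≤ L * (2 / m - 1 / ((m : ℝ) + n)) * (2 * m + n + 1) / (2 * n) := by
  have hm' : (2 : ℝ) ≤ m := by exact_mod_cast hm
  have hn' : (1 : ℝ) ≤ n := by exact_mod_cast hn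
  have hc : (0 : ℝ) < m + 1 + ((n : ℝ) - 1) / 2 := by linarith
  have h := mul_tangent_sum_le_of_gap hL hD hgap hDle (by omega : 1 ≤ m) hc n hmn.le
  have hεm := le_two_mul_div_of_recurrence hL hrec m hm
  have hεt := hεpos (m + n) (by omega)
  have hlhs : 2 * D * (2 * n / (m + 1 + ((n : ℝ) - 1) / 2)
      - n * (m + 1 + ((n : ℝ) - 1) / 2) / (m + 1 + ((n : ℝ) - 1) / 2) ^ 2)
      = 2 * (D * (2 * n) / (2 * m + n + 1)) := by
    have hc2 : (m : ℝ) + 1 + ((n : ℝ) - 1) / 2 = (2 * m + n + 1) / 2 := by ring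
    rw [hc2]
    field_simp
    ring
  rw [hlhs] at h
  have hrhs : 2 * L / m + 2 * L * (1 / m - 1 / ((m : ℝ) + n))
      = 2 * (L * (2 / m - 1 / ((m : ℝ) + n))) := by ring
  rw [le_div_iff₀ (by linarith), ← div_le_iff₀ (by linarith)]
  linarith

/-- Let `L > 0`, `γ_k = 2/(k+1)`, and let `(ε_k)` and `(Δ_k)` be nonnegative
reals satisfying, for all `k ≥ 1`, `ε_{k+1} ≤ (1 − γ_k) ε_k + (L/2) γ_k²` and
`γ_k Δ_k ≤ ε_k − ε_{k+1} + (L/2) γ_k²`.  Then for every `t ≥ 5`,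
`min_{1≤k≤t} Δ_k ≤ 4.5 L/(t − 2)`. -/
theorem cndg_gap_recurrence (L : ℝ) (hL : 0 < L) (ε Δ : ℕ → ℝ)
    (hεpos : ∀ k : ℕ, 1 ≤ k → 0 ≤ ε k)
    (hΔpos : ∀ k : ℕ, 1 ≤ k → 0 ≤ Δ k)
    (hrec : ∀ k : ℕ, 1 ≤ k →
      ε (k + 1) ≤ (1 - 2 / ((k : ℝ) + 1)) * ε k + L / 2 * (2 / ((k : ℝ) + 1)) ^ 2)
    (hgap : ∀ k : ℕ, 1 ≤ k →
      2 / ((k : ℝ) + 1) * Δ k ≤ ε k - ε (k + 1) + L / 2 * (2 / ((k : ℝ) + 1)) ^ 2) :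
    ∀ t : ℕ, ∀ ht : 5 ≤ t,
      (Finset.Icc 1 t).inf' (Finset.nonempty_Icc.mpr (by omega)) (fun k => Δ k)
        ≤ 4.5 * L / ((t : ℝ) - 2) := by
  intro t ht
  set D := (Finset.Icc 1 t).inf' (Finset.nonempty_Icc.mpr (by omega)) (fun k => Δ k)
  have hDle : ∀ k : ℕ, 1 ≤ k → k ≤ t → D ≤ Δ k := fun k h1 h2 =>
    Finset.inf'_le (fun k => Δ k) (Finset.mem_Icc.mpr ⟨h1, h2⟩)
  have hD : 0 ≤ D :=
    Finset.le_inf' _ _ fun k hk => hΔpos k (Finset.mem_Icc.mp hk).1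
  clear_value D
  obtain ⟨s, rfl | rfl⟩ := Nat.even_or_odd' t
  · have hs : (3 : ℝ) ≤ s := by exact_mod_cast (by omega : 3 ≤ s)
    refine (le_of_gap_recurrence hL hD hεpos hrec hgap hDle (m := s) (n := s + 1)
      (by omega) (by omega) (by omega)).trans ?_
    push_cast
    have hid : L * (2 / s - 1 / ((s : ℝ) + (s + 1))) * (2 * s + (s + 1) + 1) / (2 * (s + 1))
        = L * (3 * s + 2) ^ 2 / (2 * s * (2 * s + 1) * (s + 1)) := by
      have : (s : ℝ) + (s + 1) = 2 * s + 1 := by ring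
      rw [this]
      field_simp
      ring
    rw [hid, div_le_div_iff₀ (by positivity) (by linarith), mul_assoc, mul_comm (4.5 : ℝ) L,
      mul_assoc L]
    refine mul_le_mul_of_nonneg_left ?_ hL.le
    nlinarith
  · have hs : (2 : ℝ) ≤ s := by exact_mod_cast (by omega : 2 ≤ s)
    refine (le_of_gap_recurrence hL hD hεpos hrec hgap hDle (m := s + 1) (n := s + 1)
      (by omega) (by omega) (by omega)).trans ?_
    push_cast
    have hid : L * (2 / ((s : ℝ) + 1) - 1 / ((s : ℝ) + 1 + (s + 1)))
        * (2 * (s + 1) + (s + 1) + 1) / (2 * (s + 1))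
        = L * (3 * (3 * s + 4)) / (4 * (s + 1) ^ 2) := by
      have : (s : ℝ) + 1 + (s + 1) = 2 * (s + 1) := by ring
      rw [this]
      field_simp
      ring
    rw [hid, div_le_div_iff₀ (by positivity) (by linarith), mul_assoc, mul_comm (4.5 : ℝ) L,
      mul_assoc L]
    refine mul_le_mul_of_nonneg_left ?_ hL.le
    nlinarith
end

section
/- Let m ≥ 1, β ∈ [2, ∞), and φ(y) = (1/2)‖y‖_β² on ℝ^m, where ‖y‖_β = (∑_{i=1}^m |y_i|^β)^{1/β}. Then φ is differentiable and its gradient satisfies ‖φ'(y) − φ'(y')‖₁ ≤ (β − 1) m^{2/β} ‖y − y'‖_∞ for all y, y' ∈ ℝ^m. -/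
/-- The derivative of `x ↦ |x| ^ p * x` for `p ≥ 0`. -/
theorem hasDerivAt_abs_rpow_mul_self {p : ℝ} (hp : 0 ≤ p) (x : ℝ) :
    HasDerivAt (fun x : ℝ => |x| ^ p * x) ((p + 1) * |x| ^ p) x := by
  rcases eq_or_ne x 0 with rfl | hx
  · rw [hasDerivAt_iff_tendsto_slope]
    have h1 : Filter.Tendsto (fun x : ℝ => |x| ^ p) (nhdsWithin 0 {0}ᶜ) (nhds (|(0 : ℝ)| ^ p)) :=
      ((continuous_abs.rpow_const fun _ => Or.inr hp).tendsto 0).mono_left nhdsWithin_le_nhds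
    have h2 : (p + 1) * |(0 : ℝ)| ^ p = |(0 : ℝ)| ^ p := by
      rcases hp.eq_or_lt with rfl | hp'
      · simp
      · simp [Real.zero_rpow hp'.ne']
    rw [h2]
    refine h1.congr' ?_
    filter_upwards [self_mem_nhdsWithin] with t ht
    have ht : t ≠ 0 := ht
    simp only [slope, vsub_eq_sub, sub_zero, mul_zero, smul_eq_mul]
    field_simp
  · have h := ((hasDerivAt_abs hx).rpow_const (p := p)
      (Or.inl (abs_ne_zero.mpr hx))).mul (hasDerivAt_id x)
    refine h.congr_deriv ?_
    have hs : (SignType.sign x : ℝ) * x = |x| := sign_mul_self x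
    have hr : |x| ^ (p - 1) * |x| = |x| ^ p := by
      rw [← Real.rpow_add_one (abs_ne_zero.mpr hx)]; simp
    simp only [id, mul_one]
    linear_combination p * |x| ^ (p - 1) * hs + p * hr

section WeightedForms

variable {ι : Type*} [Fintype ι]

theorem abs_sum_weight_mul_le (w u v : ι → ℝ) (hw : ∀ i, 0 ≤ w i) :
    |∑ i, w i * u i * v i| ≤ (∑ i, w i) * ‖u‖ * ‖v‖ := by
  rw [Finset.sum_mul, Finset.sum_mul]
  refine (Finset.abs_sum_le_sum_abs _ _).trans (Finset.sum_le_sum fun i _ => ?_)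
  rw [abs_mul, abs_mul, abs_of_nonneg (hw i)]
  have := hw i
  gcongr
  · exact norm_le_pi_norm u i
  · exact norm_le_pi_norm v i

/-- The weighted inner product of `v` with the component of `u` orthogonal to `y`. -/
theorem abs_sum_weight_mul_sub_proj_le (w y u v : ι → ℝ) (hw : ∀ i, 0 ≤ w i)
    (hS : 0 < ∑ i, w i * y i * y i) :
    |(∑ i, w i * u i * v i) -
        (∑ i, w i * y i * u i) * (∑ i, w i * y i * v i) / (∑ i, w i * y i * y i)|
      ≤ (∑ i, w i) * ‖u‖ * ‖v‖ := by
  set S := ∑ i, w i * y i * y i with hSdef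
  set a := ∑ i, w i * y i * u i with ha
  set c := a / S with hc
  have hcS : c * S = a := div_mul_cancel₀ _ hS.ne'
  have hW : 0 ≤ ∑ i, w i := Finset.sum_nonneg fun i _ => hw i
  have e1 : (∑ i, w i * u i * v i) - a * (∑ i, w i * y i * v i) / S
      = ∑ i, (√(w i) * (u i - c * y i)) * (√(w i) * v i) := by
    have : a * (∑ i, w i * y i * v i) / S = c * ∑ i, w i * y i * v i := by rw [hc]; ring
    rw [this, Finset.mul_sum, ← Finset.sum_sub_distrib]
    refine Finset.sum_congr rfl fun i _ => ?_
    linear_combination (-(u i - c * y i) * v i) * Real.mul_self_sqrt (hw i)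
  have e2 : ∑ i, (√(w i) * (u i - c * y i)) ^ 2 = (∑ i, w i * u i * u i) - c ^ 2 * S := by
    have : (∑ i, w i * u i * u i) - c ^ 2 * S
        = (∑ i, w i * u i * u i) - 2 * c * a + c ^ 2 * S := by rw [← hcS]; ring
    rw [this, ha, hSdef, Finset.mul_sum, Finset.mul_sum, ← Finset.sum_sub_distrib,
      ← Finset.sum_add_distrib]
    refine Finset.sum_congr rfl fun i _ => ?_
    rw [mul_pow, Real.sq_sqrt (hw i)]; ring
  have e3 : ∑ i, (√(w i) * v i) ^ 2 = ∑ i, w i * v i * v i :=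
    Finset.sum_congr rfl fun i _ => by rw [mul_pow, Real.sq_sqrt (hw i)]; ring
  rw [e1]
  refine abs_le_of_sq_le_sq ?_ (by positivity)
  refine (Finset.sum_mul_sq_le_sq_mul_sq _ _ _).trans ?_
  have hu := (le_abs_self _).trans (abs_sum_weight_mul_le w u u hw)
  have hv := (le_abs_self _).trans (abs_sum_weight_mul_le w v v hw)
  rw [e2, e3]
  calc _ ≤ ((∑ i, w i) * ‖u‖ * ‖u‖) * ((∑ i, w i) * ‖v‖ * ‖v‖) := by
        refine mul_le_mul (by nlinarith [mul_nonneg (sq_nonneg c) hS.le]) hv ?_ (by positivity)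
        rw [← e3]; positivity
    _ = _ := by ring

/-- Comparison of the power sums of exponents `β - 2` and `β`. -/
theorem sum_abs_rpow_sub_two_le {β : ℝ} (hβ : 2 ≤ β) (y : ι → ℝ) :
    ∑ i, |y i| ^ (β - 2) ≤ (∑ i, |y i| ^ β) ^ (1 - 2 / β) * (Fintype.card ι : ℝ) ^ (2 / β) := by
  rcases hβ.eq_or_lt with rfl | hβ'
  · simp
  have hb : 0 < β - 2 := by linarith
  have hpq : (β / (β - 2)).HolderConjugate (β / 2) := by
    rw [Real.holderConjugate_iff]
    refine ⟨by rw [lt_div_iff₀ hb]; linarith, by field_simp; ring⟩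
  have h := Real.inner_le_Lp_mul_Lq_of_nonneg Finset.univ hpq
    (f := fun i => |y i| ^ (β - 2)) (g := fun _ => (1 : ℝ))
    (fun i _ => by positivity) (fun _ _ => zero_le_one)
  have e : ∀ i, (|y i| ^ (β - 2)) ^ (β / (β - 2)) = |y i| ^ β := fun i => by
    rw [← Real.rpow_mul (abs_nonneg _)]; congr 1; field_simp
  have e' : 1 / (β / (β - 2)) = 1 - 2 / β := by field_simp
  have e'' : 1 / (β / 2) = 2 / β := one_div_div _ _
  rw [e', e''] at h
  simpa [e] using h

end WeightedForms

section SmoothedFit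

variable {ι : Type*} [Fintype ι]

/-- The pairing with `v` of the gradient at `y` of `(1/2) * ‖y‖_β ^ 2`. -/
noncomputable def halfSqLpGrad (β : ℝ) (y v : ι → ℝ) : ℝ :=
  (∑ i, |y i| ^ β) ^ (2 / β - 1) * ∑ i, |y i| ^ (β - 2) * y i * v i

theorem abs_rpow_sub_two_mul_mul {β : ℝ} (hβ : 2 ≤ β) (x : ℝ) :
    |x| ^ (β - 2) * x * x = |x| ^ β := by
  rcases eq_or_ne x 0 with rfl | hx
  · simp [Real.zero_rpow (by linarith : β ≠ 0)]
  · rw [mul_assoc, ← abs_mul_abs_self x, ← pow_two, ← Real.rpow_natCast,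
      ← Real.rpow_add (abs_pos.mpr hx)]
    norm_num

theorem sum_abs_rpow_pos {y : ι → ℝ} (hy : y ≠ 0) (β : ℝ) : 0 < ∑ i, |y i| ^ β := by
  obtain ⟨i, hi⟩ := Function.ne_iff.mp hy
  exact Finset.sum_pos' (fun j _ => by positivity)
    ⟨i, Finset.mem_univ i, Real.rpow_pos_of_pos (abs_pos.mpr hi) _⟩

theorem rpow_mul_sum_abs_rpow_sub_two_le {β : ℝ} (hβ : 2 ≤ β) {y : ι → ℝ} (hy : y ≠ 0) :
    (∑ i, |y i| ^ β) ^ (2 / β - 1) * ∑ i, |y i| ^ (β - 2) ≤ (Fintype.card ι : ℝ) ^ (2 / β) := by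
  have hS := sum_abs_rpow_pos hy β
  calc _ ≤ _ := mul_le_mul_of_nonneg_left (sum_abs_rpow_sub_two_le hβ y) (by positivity)
    _ = _ := by
      rw [← mul_assoc, ← Real.rpow_add hS]; simp

theorem abs_halfSqLpGrad_le {β : ℝ} (hβ : 2 ≤ β) (y v : ι → ℝ) :
    |halfSqLpGrad β y v| ≤ (Fintype.card ι : ℝ) ^ (2 / β) * ‖y‖ * ‖v‖ := by
  rcases eq_or_ne y 0 with rfl | hy
  · simp [halfSqLpGrad]
  have hS := sum_abs_rpow_pos hy β
  rw [halfSqLpGrad, abs_mul, abs_of_pos (Real.rpow_pos_of_pos hS _)]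
  calc _ ≤ (∑ i, |y i| ^ β) ^ (2 / β - 1) * ((∑ i, |y i| ^ (β - 2)) * ‖y‖ * ‖v‖) := by
        gcongr
        exact abs_sum_weight_mul_le _ y v fun i => by positivity
    _ = ((∑ i, |y i| ^ β) ^ (2 / β - 1) * ∑ i, |y i| ^ (β - 2)) * ‖y‖ * ‖v‖ := by ring
    _ ≤ _ := by gcongr; exact rpow_mul_sum_abs_rpow_sub_two_le hβ hy

/-- The derivative of the gradient along a line, away from the origin. -/
theorem hasDerivAt_halfSqLpGrad_line {β : ℝ} (hβ : 2 ≤ β) (y h v : ι → ℝ) (t : ℝ)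
    (ht : y + t • h ≠ 0) :
    ∃ f' : ℝ, HasDerivAt (fun s : ℝ => halfSqLpGrad β (y + s • h) v) f' t ∧
      |f'| ≤ (β - 1) * (Fintype.card ι : ℝ) ^ (2 / β) * ‖h‖ * ‖v‖ := by
  set z := y + t • h with hz
  have hS := sum_abs_rpow_pos ht β
  have hline : ∀ i, HasDerivAt (fun s : ℝ => (y + s • h) i) (h i) t := fun i => by
    simpa using ((hasDerivAt_id t).mul_const (h i)).const_add (y i)
  have d1 : HasDerivAt (fun s : ℝ => ∑ i, |(y + s • h) i| ^ β)
      (∑ i, β * |z i| ^ (β - 2) * z i * h i) t :=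
    HasDerivAt.fun_sum fun i _ =>
      HasDerivAt.comp (h₂ := fun x : ℝ => |x| ^ β) t
        (hasDerivAt_abs_rpow (z i) (by linarith : 1 < β)) (hline i)
  have d2 : HasDerivAt (fun s : ℝ => ∑ i, |(y + s • h) i| ^ (β - 2) * (y + s • h) i * v i)
      (∑ i, (β - 2 + 1) * |z i| ^ (β - 2) * h i * v i) t :=
    HasDerivAt.fun_sum fun i _ =>
      (HasDerivAt.comp (h₂ := fun x : ℝ => |x| ^ (β - 2) * x) t
        (hasDerivAt_abs_rpow_mul_self (by linarith : 0 ≤ β - 2) (z i)) (hline i)).mul_const (v i)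
  refine ⟨_, (d1.rpow_const (p := 2 / β - 1) (Or.inl hS.ne')).mul d2, ?_⟩
  rw [← hz]
  have hw : ∀ i, 0 ≤ |z i| ^ (β - 2) := fun i => by positivity
  have hSS : ∑ i, |z i| ^ (β - 2) * z i * z i = ∑ i, |z i| ^ β :=
    Finset.sum_congr rfl fun i _ => abs_rpow_sub_two_mul_mul hβ (z i)
  have b1 := abs_sum_weight_mul_le (fun i => |z i| ^ (β - 2)) h v hw
  have b2 := abs_sum_weight_mul_sub_proj_le (fun i => |z i| ^ (β - 2)) z h v hw
    (by rw [hSS]; exact hS)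
  have b3 := rpow_mul_sum_abs_rpow_sub_two_le hβ ht
  rw [hSS] at b2
  have s1 : ∑ i, β * |z i| ^ (β - 2) * z i * h i = β * ∑ i, |z i| ^ (β - 2) * z i * h i := by
    rw [Finset.mul_sum]; exact Finset.sum_congr rfl fun i _ => by ring
  have s2 : ∑ i, (β - 2 + 1) * |z i| ^ (β - 2) * h i * v i
      = (β - 1) * ∑ i, |z i| ^ (β - 2) * h i * v i := by
    rw [Finset.mul_sum]; exact Finset.sum_congr rfl fun i _ => by ring
  rw [s1, s2, Real.rpow_sub_one hS.ne' (2 / β - 1)]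
  set S := ∑ i, |z i| ^ β
  set P := S ^ (2 / β - 1) with hP
  set A := ∑ i, |z i| ^ (β - 2) * z i * h i
  set B := ∑ i, |z i| ^ (β - 2) * z i * v i
  set C := ∑ i, |z i| ^ (β - 2) * h i * v i
  set W := ∑ i, |z i| ^ (β - 2)
  have hPpos : 0 < P := Real.rpow_pos_of_pos hS _
  have hβ0 : β ≠ 0 := by linarith
  have key : β * A * (2 / β - 1) * (P / S) * B + P * ((β - 1) * C)
      = P * (C + (β - 2) * (C - A * B / S)) := by
    field_simp; ring
  rw [key, abs_mul, abs_of_pos hPpos]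
  calc P * |C + (β - 2) * (C - A * B / S)|
      ≤ P * (|C| + (β - 2) * |C - A * B / S|) := by
        gcongr
        refine (abs_add_le _ _).trans ?_
        rw [abs_mul, abs_of_nonneg (by linarith : 0 ≤ β - 2)]
    _ ≤ P * (W * ‖h‖ * ‖v‖ + (β - 2) * (W * ‖h‖ * ‖v‖)) := by
        have : 0 ≤ β - 2 := by linarith
        gcongr
    _ = (β - 1) * (P * W) * ‖h‖ * ‖v‖ := by ring
    _ ≤ _ := by
        have : 0 ≤ β - 1 := by linarith
        gcongr

theorem abs_halfSqLpGrad_sub_le {β : ℝ} (hβ : 2 ≤ β) (y y' v : ι → ℝ) :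
    |halfSqLpGrad β y v - halfSqLpGrad β y' v|
      ≤ (β - 1) * (Fintype.card ι : ℝ) ^ (2 / β) * ‖y - y'‖ * ‖v‖ := by
  set h := y - y' with hh
  by_cases hex : ∃ t ∈ Set.Icc (0 : ℝ) 1, y' + t • h = 0
  · obtain ⟨t, ⟨ht0, ht1⟩, hzero⟩ := hex
    have hy' : y' = (-t) • h := by rw [neg_smul]; exact eq_neg_of_add_eq_zero_left hzero
    have hy : y = (1 - t) • h := by
      rw [sub_smul, one_smul, sub_eq_add_neg, ← neg_smul, ← hy', hh]; abel
    have ny' : ‖y'‖ = t * ‖h‖ := by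
      rw [hy', norm_smul, Real.norm_eq_abs, abs_neg, abs_of_nonneg ht0]
    have ny : ‖y‖ = (1 - t) * ‖h‖ := by
      rw [hy, norm_smul, Real.norm_eq_abs, abs_of_nonneg (by linarith)]
    have h1 := abs_halfSqLpGrad_le hβ y v
    have h2 := abs_halfSqLpGrad_le hβ y' v
    rw [ny] at h1
    rw [ny'] at h2
    set K := (Fintype.card ι : ℝ) ^ (2 / β)
    have hK : 0 ≤ K * ‖h‖ * ‖v‖ := by positivity
    calc _ ≤ _ := abs_sub _ _
      _ ≤ K * ((1 - t) * ‖h‖) * ‖v‖ + K * (t * ‖h‖) * ‖v‖ := add_le_add h1 h2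
      _ = K * ‖h‖ * ‖v‖ := by ring
      _ ≤ _ := by nlinarith
  · push Not at hex
    choose! f' hf' hb using fun t ht =>
      hasDerivAt_halfSqLpGrad_line hβ y' h v t (hex t ht)
    have := (convex_Icc (0 : ℝ) 1).norm_image_sub_le_of_norm_hasDerivWithin_le
      (fun t ht => (hf' t ht).hasDerivWithinAt) hb
      (Set.left_mem_Icc.mpr zero_le_one) (Set.right_mem_Icc.mpr zero_le_one)
    simpa [hh] using this

theorem exists_hasFDerivAt_halfSqLp {β : ℝ} (hβ : 2 ≤ β) (y : ι → ℝ) :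
    ∃ L : (ι → ℝ) →L[ℝ] ℝ,
      HasFDerivAt (fun y : ι → ℝ => (1 / 2) * (∑ i, |y i| ^ β) ^ (2 / β)) L y ∧
      ∀ v, L v = halfSqLpGrad β y v := by
  have hβ0 : 0 < β := by linarith
  rcases eq_or_ne y 0 with rfl | hy
  · refine ⟨0, ?_, fun v => by simp [halfSqLpGrad]⟩
    refine Asymptotics.IsBigO.hasFDerivAt (n := 2) ?_ one_lt_two
    refine Asymptotics.IsBigO.of_bound ((1 / 2) * (Fintype.card ι : ℝ) ^ (2 / β))
      (Filter.Eventually.of_forall fun z => ?_)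
    have hsum : ∑ i, |z i| ^ β ≤ (Fintype.card ι : ℝ) * ‖z‖ ^ β := by
      calc _ ≤ ∑ _i : ι, ‖z‖ ^ β := Finset.sum_le_sum fun i _ =>
            Real.rpow_le_rpow (abs_nonneg _) (norm_le_pi_norm z i) hβ0.le
        _ = _ := by simp
    have hsum0 : 0 ≤ ∑ i, |z i| ^ β := by positivity
    rw [Real.norm_of_nonneg (by positivity), sub_zero, Real.norm_of_nonneg (by positivity),
      mul_assoc]
    gcongr
    calc _ ≤ ((Fintype.card ι : ℝ) * ‖z‖ ^ β) ^ (2 / β) :=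
          Real.rpow_le_rpow hsum0 hsum (by positivity)
      _ = _ := by
          rw [Real.mul_rpow (by positivity) (by positivity), ← Real.rpow_mul (norm_nonneg _),
            mul_div_cancel₀ _ hβ0.ne', Real.rpow_two]
  · have hS := sum_abs_rpow_pos hy β
    have d1 : HasFDerivAt (fun z : ι → ℝ => ∑ i, |z i| ^ β)
        (∑ i, (β * |y i| ^ (β - 2) * y i) • ContinuousLinearMap.proj (R := ℝ) i) y :=
      HasFDerivAt.fun_sum fun i _ =>
        HasDerivAt.comp_hasFDerivAt (h₂ := fun x : ℝ => |x| ^ β) y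
          (hasDerivAt_abs_rpow (y i) (by linarith : 1 < β)) (hasFDerivAt_apply (𝕜 := ℝ) i y)
    refine ⟨_, (d1.rpow_const (p := 2 / β) (Or.inl hS.ne')).const_mul (1 / 2), fun v => ?_⟩
    simp only [smul_apply, sum_apply,
      ContinuousLinearMap.proj_apply, smul_eq_mul, halfSqLpGrad, Finset.mul_sum]
    refine Finset.sum_congr rfl fun i _ => ?_
    field_simp

end SmoothedFit

/-- Let `m ≥ 1`, `β ∈ [2, ∞)`, and `φ(y) = (1/2)‖y‖_β²` on `ℝ^m`.  Then
`φ` is differentiable and `‖φ'(y) − φ'(y')‖₁ ≤ (β − 1) m^{2/β} ‖y − y'‖_∞`.  Here `ℝ^m`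
carries the sup norm, so the operator norm of the derivative is the `ℓ₁` norm of the
gradient. -/
theorem smoothed_linf_fit_lipschitz (m : ℕ) (hm : 1 ≤ m) (β : ℝ) (hβ : 2 ≤ β) :
    Differentiable ℝ (fun y : Fin m → ℝ => (1 / 2) * (∑ i, |y i| ^ β) ^ (2 / β)) ∧
    ∀ y y' : Fin m → ℝ,
      ‖fderiv ℝ (fun y : Fin m → ℝ => (1 / 2) * (∑ i, |y i| ^ β) ^ (2 / β)) y -
        fderiv ℝ (fun y : Fin m → ℝ => (1 / 2) * (∑ i, |y i| ^ β) ^ (2 / β)) y'‖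
      ≤ (β - 1) * (m : ℝ) ^ (2 / β) * ‖y - y'‖ := by
  choose L hL hLv using exists_hasFDerivAt_halfSqLp (ι := Fin m) hβ
  refine ⟨fun y => (hL y).differentiableAt, fun y y' => ?_⟩
  rw [(hL y).fderiv, (hL y').fderiv]
  have : 0 ≤ β - 1 := by linarith
  refine ContinuousLinearMap.opNorm_le_bound _ (by positivity) fun v => ?_
  rw [sub_apply, hLv, hLv, Real.norm_eq_abs]
  simpa using abs_halfSqLpGrad_sub_le hβ y y' v
end

section
/- Let m ≥ 1, β > 0, and φ(y) = (1/β) ln(∑_{i=1}^m [e^{β y_i} + e^{−β y_i}]) for y ∈ ℝ^m. Then φ is differentiable and ‖φ'(y) − φ'(y')‖₁ ≤ β ‖y − y'‖_∞ for all y, y' ∈ ℝ^m. -/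
/-- A covariance-type bound: if `|s i| ≤ c i`, then the symmetric bilinear form
`(∑ c) (∑ v w c) - (∑ v s) (∑ w s)` is bounded by `(∑ c) ^ 2` times sup bounds of `v`, `w`. -/
theorem sum_mul_sum_sub_le {ι : Type*} [Fintype ι] {c s v w : ι → ℝ} {V W : ℝ}
    (hs : ∀ i, |s i| ≤ c i) (hv : ∀ i, |v i| ≤ V) (hw : ∀ i, |w i| ≤ W)
    (hV : 0 ≤ V) (hW : 0 ≤ W) :
    (∑ i, v i * w i * c i) * (∑ i, c i) - (∑ i, v i * s i) * (∑ i, w i * s i)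
      ≤ V * W * (∑ i, c i) ^ 2 := by
  have hc : ∀ i, 0 ≤ c i := fun i => (abs_nonneg _).trans (hs i)
  rcases hV.eq_or_lt with rfl | hV
  · have : ∀ i, v i = 0 := fun i => abs_nonpos_iff.1 (hv i)
    simp [this]
  rcases hW.eq_or_lt with rfl | hW
  · have : ∀ i, w i = 0 := fun i => abs_nonpos_iff.1 (hw i)
    simp [this]
  have hC : 0 ≤ ∑ i, c i := Finset.sum_nonneg fun i _ => hc i
  have cauchy : (∑ i, (W * v i - V * w i) * s i) ^ 2
      ≤ (∑ i, (W * v i - V * w i) ^ 2 * c i) * ∑ i, c i := by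
    refine Finset.sum_sq_le_sum_mul_sum_of_sq_le_mul _
      (fun i _ => mul_nonneg (sq_nonneg _) (hc i)) (fun i _ => hc i) fun i _ => ?_
    have h : s i ^ 2 ≤ c i ^ 2 := sq_le_sq.2 ((hs i).trans (le_abs_self _))
    calc ((W * v i - V * w i) * s i) ^ 2 = (W * v i - V * w i) ^ 2 * s i ^ 2 := by ring
      _ ≤ (W * v i - V * w i) ^ 2 * c i ^ 2 := by gcongr
      _ = _ := by ring
  have upper : ∑ i, (W * v i + V * w i) ^ 2 * c i ≤ (2 * V * W) ^ 2 * ∑ i, c i := by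
    rw [Finset.mul_sum]
    refine Finset.sum_le_sum fun i _ => mul_le_mul_of_nonneg_right ?_ (hc i)
    have h1 := abs_le.1 (hv i)
    have h2 := abs_le.1 (hw i)
    refine sq_le_sq' ?_ ?_ <;> nlinarith
  have key : 4 * (V * W) * ((∑ i, v i * w i * c i) * (∑ i, c i)
        - (∑ i, v i * s i) * (∑ i, w i * s i))
      = (∑ i, (W * v i + V * w i) ^ 2 * c i) * (∑ i, c i)
        - (W * (∑ i, v i * s i) + V * (∑ i, w i * s i)) ^ 2
        - ((∑ i, (W * v i - V * w i) ^ 2 * c i) * (∑ i, c i)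
          - (∑ i, (W * v i - V * w i) * s i) ^ 2) := by
    have e1 : ∑ i, (W * v i + V * w i) ^ 2 * c i - ∑ i, (W * v i - V * w i) ^ 2 * c i
        = 4 * (V * W) * ∑ i, v i * w i * c i := by
      rw [← Finset.sum_sub_distrib, Finset.mul_sum]
      exact Finset.sum_congr rfl fun i _ => by ring
    have e2 : ∑ i, (W * v i - V * w i) * s i
        = W * (∑ i, v i * s i) - V * (∑ i, w i * s i) := by
      rw [Finset.mul_sum, Finset.mul_sum, ← Finset.sum_sub_distrib]
      exact Finset.sum_congr rfl fun i _ => by ring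
    rw [e2]
    linear_combination -(∑ i, c i) * e1
  have hVW : 0 < 4 * (V * W) := by positivity
  refine le_of_mul_le_mul_left ?_ hVW
  have := mul_le_mul_of_nonneg_right upper hC
  nlinarith [sq_nonneg (W * (∑ i, v i * s i) + V * (∑ i, w i * s i))]

/-- Absolute-value version of `sum_mul_sum_sub_le`. -/
theorem abs_sum_mul_sum_sub_le {ι : Type*} [Fintype ι] {c s v w : ι → ℝ} {V W : ℝ}
    (hs : ∀ i, |s i| ≤ c i) (hv : ∀ i, |v i| ≤ V) (hw : ∀ i, |w i| ≤ W)
    (hV : 0 ≤ V) (hW : 0 ≤ W) :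
    |(∑ i, v i * w i * c i) * (∑ i, c i) - (∑ i, v i * s i) * (∑ i, w i * s i)|
      ≤ V * W * (∑ i, c i) ^ 2 := by
  refine abs_le'.2 ⟨sum_mul_sum_sub_le hs hv hw hV hW, ?_⟩
  have h := sum_mul_sum_sub_le (v := fun i => -v i) hs (fun i => by simpa using hv i) hw hV hW
  simp only [neg_mul, Finset.sum_neg_distrib] at h
  linarith

theorem sum_exp_add_exp_neg_pos {ι : Type*} [Fintype ι] [Nonempty ι] (x : ι → ℝ) :
    0 < ∑ i, (Real.exp (x i) + Real.exp (-x i)) :=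
  Finset.sum_pos (fun i _ => by positivity) Finset.univ_nonempty

theorem abs_exp_sub_exp_neg_le (x : ℝ) :
    |Real.exp x - Real.exp (-x)| ≤ Real.exp x + Real.exp (-x) := by
  have h1 := Real.exp_pos x
  have h2 := Real.exp_pos (-x)
  exact abs_le.2 ⟨by linarith, by linarith⟩

/-- The gradient of the two-sided logistic function. -/
theorem hasFDerivAt_logistic {ι : Type*} [Fintype ι] [Nonempty ι] {β : ℝ} (hβ : β ≠ 0)
    (y : ι → ℝ) :
    HasFDerivAt (fun y : ι → ℝ =>
        (1 / β) * Real.log (∑ i, (Real.exp (β * y i) + Real.exp (-(β * y i)))))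
      ((∑ i, (Real.exp (β * y i) + Real.exp (-(β * y i))))⁻¹ •
        ∑ i, (Real.exp (β * y i) - Real.exp (-(β * y i))) •
          (ContinuousLinearMap.proj i : (ι → ℝ) →L[ℝ] ℝ)) y := by
  have hpos := sum_exp_add_exp_neg_pos fun i => β * y i
  have hlin : ∀ i, HasFDerivAt (fun y : ι → ℝ => β * y i)
      (β • (ContinuousLinearMap.proj i : (ι → ℝ) →L[ℝ] ℝ)) y :=
    fun i => (hasFDerivAt_apply i y).const_mul β
  have hsum := HasFDerivAt.fun_sum (u := Finset.univ) fun i _ =>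
    (hlin i).exp.add (hlin i).fun_neg.exp
  refine ((hsum.log hpos.ne').const_mul (1 / β)).congr_fderiv ?_
  ext v
  simp only [smul_apply, sum_apply,
    add_apply, neg_apply, ContinuousLinearMap.proj_apply,
    smul_eq_mul]
  rw [mul_left_comm, Finset.mul_sum]
  congr 1
  refine Finset.sum_congr rfl fun i _ => ?_
  field_simp
  ring

/-- The directional derivatives of the two-sided logistic function are Lipschitz along lines. -/
theorem abs_logistic_gradient_sub_le {ι : Type*} [Fintype ι] [Nonempty ι] {β : ℝ} (hβ : 0 ≤ β)
    (y y' v : ι → ℝ) :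
    |(∑ i, (Real.exp (β * y i) + Real.exp (-(β * y i))))⁻¹ *
        ∑ i, v i * (Real.exp (β * y i) - Real.exp (-(β * y i))) -
      (∑ i, (Real.exp (β * y' i) + Real.exp (-(β * y' i))))⁻¹ *
        ∑ i, v i * (Real.exp (β * y' i) - Real.exp (-(β * y' i)))|
      ≤ β * ‖y - y'‖ * ‖v‖ := by
  set w : ι → ℝ := y - y' with hw
  let x : ℝ → ι → ℝ := fun t i => β * (y' i + t * w i)
  let S : ℝ → ℝ := fun t => ∑ i, (Real.exp (x t i) + Real.exp (-x t i))
  let N : ℝ → ℝ := fun t => ∑ i, v i * (Real.exp (x t i) - Real.exp (-x t i))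
  have hS : ∀ t, 0 < S t := fun t => sum_exp_add_exp_neg_pos _
  have hx : ∀ t i, HasDerivAt (fun t => x t i) (β * w i) t := fun t i => by
    simpa using (((hasDerivAt_id t).mul_const (w i)).const_add (y' i)).const_mul β
  have hS' : ∀ t, HasDerivAt S
      (β * ∑ i, w i * (Real.exp (x t i) - Real.exp (-x t i))) t := fun t => by
    refine (HasDerivAt.fun_sum (u := Finset.univ) fun i _ =>
      (hx t i).exp.add (hx t i).fun_neg.exp).congr_deriv ?_
    rw [Finset.mul_sum]
    exact Finset.sum_congr rfl fun i _ => by ring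
  have hN' : ∀ t, HasDerivAt N
      (β * ∑ i, v i * w i * (Real.exp (x t i) + Real.exp (-x t i))) t := fun t => by
    refine (HasDerivAt.fun_sum (u := Finset.univ) fun i _ =>
      ((hx t i).exp.sub (hx t i).fun_neg.exp).const_mul (v i)).congr_deriv ?_
    rw [Finset.mul_sum]
    exact Finset.sum_congr rfl fun i _ => by ring
  have bound : ∀ t ∈ Set.Ico (0 : ℝ) 1, ‖((β * ∑ i, v i * w i *
      (Real.exp (x t i) + Real.exp (-x t i))) * S t - N t *
      (β * ∑ i, w i * (Real.exp (x t i) - Real.exp (-x t i)))) / S t ^ 2‖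
      ≤ β * ‖w‖ * ‖v‖ := fun t _ => by
    have h := abs_sum_mul_sum_sub_le (fun i => abs_exp_sub_exp_neg_le (x t i))
      (norm_le_pi_norm v) (norm_le_pi_norm w) (norm_nonneg v) (norm_nonneg w)
    have h2 : 0 < S t ^ 2 := pow_pos (hS t) 2
    rw [Real.norm_eq_abs, abs_div, abs_of_pos h2, div_le_iff₀ h2]
    rw [show ∀ a b c d : ℝ, β * a * b - c * (β * d) = β * (a * b - c * d) by intros; ring,
      abs_mul, abs_of_nonneg hβ]
    calc _ ≤ β * (‖v‖ * ‖w‖ * S t ^ 2) := mul_le_mul_of_nonneg_left h hβ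
      _ = _ := by ring
  have main := norm_image_sub_le_of_norm_deriv_le_segment_01'
    (fun t _ => ((hN' t).div (hS' t) (hS t).ne').hasDerivWithinAt) bound
  simpa [N, S, x, hw, div_eq_inv_mul] using main

/-- Let `m ≥ 1`, `β > 0`, and
`φ(y) = (1/β) ln(∑_{i=1}^m [e^{β y_i} + e^{−β y_i}])` on `ℝ^m`.  Then `φ` is differentiable
and `‖φ'(y) − φ'(y')‖₁ ≤ β ‖y − y'‖_∞`.  Here `ℝ^m` carries the sup norm, so the operator
norm of the derivative is the `ℓ₁` norm of the gradient. -/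
theorem logistic_gradient_lipschitz (m : ℕ) (hm : 1 ≤ m) (β : ℝ) (hβ : 0 < β) :
    Differentiable ℝ (fun y : Fin m → ℝ =>
      (1 / β) * Real.log (∑ i, (Real.exp (β * y i) + Real.exp (-(β * y i))))) ∧
    ∀ y y' : Fin m → ℝ,
      ‖fderiv ℝ (fun y : Fin m → ℝ =>
          (1 / β) * Real.log (∑ i, (Real.exp (β * y i) + Real.exp (-(β * y i))))) y -
        fderiv ℝ (fun y : Fin m → ℝ =>
          (1 / β) * Real.log (∑ i, (Real.exp (β * y i) + Real.exp (-(β * y i))))) y'‖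
      ≤ β * ‖y - y'‖ := by
  have : Nonempty (Fin m) := ⟨⟨0, hm⟩⟩
  have hd := hasFDerivAt_logistic (ι := Fin m) hβ.ne'
  refine ⟨fun y => (hd y).differentiableAt, fun y y' => ?_⟩
  rw [(hd y).fderiv, (hd y').fderiv]
  refine ContinuousLinearMap.opNorm_le_bound _ (by positivity) fun v => ?_
  simpa [mul_comm (v _)] using abs_logistic_gradient_sub_le hβ.le y y' v
end

section
/- Let f : E → ℝ be convex and differentiable on K, let f(0) > 0, and let d = −min{⟨f'(0), x⟩ : x ∈ K, ‖x‖ ≤ 1} be positive. Then f(x) ≥ f(0) − d‖x‖ for all x ∈ K, and consequently every x ∈ K with f(x) ≤ 0 satisfies ‖x‖ ≥ f(0)/d; in particular, ρ_* = min{‖x‖ : x ∈ K, f(x) ≤ 0} ≥ f(0)/d > 0. -/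
open RealInnerProductSpace

/-- First-order lower bound for a convex function, at a point where it has a gradient. -/
theorem ConvexOn.add_inner_gradient_le
    {E : Type*} [NormedAddCommGroup E] [InnerProductSpace ℝ E] [CompleteSpace E]
    {K : Set E} {f : E → ℝ} {g x y : E} (hf : ConvexOn ℝ K f)
    (hx : x ∈ K) (hy : y ∈ K) (hg : HasGradientAt f g x) :
    f x + ⟪g, y - x⟫ ≤ f y := by
  have hconv : ConvexOn ℝ (AffineMap.lineMap x y ⁻¹' K : Set ℝ)
      (f ∘ (AffineMap.lineMap x y : ℝ →ᵃ[ℝ] E)) := hf.comp_affineMap _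
  have hderiv : HasDerivAt (f ∘ (AffineMap.lineMap x y : ℝ →ᵃ[ℝ] E)) ⟪g, y - x⟫ 0 := by
    have hline : HasDerivAt (AffineMap.lineMap x y : ℝ → E) (y - x) 0 :=
      AffineMap.hasDerivAt_lineMap
    have hg' : HasFDerivAt f (InnerProductSpace.toDual ℝ E g)
        ((AffineMap.lineMap x y : ℝ → E) 0) := by
      simpa using hg.hasFDerivAt
    simpa using hg'.comp_hasDerivAt 0 hline
  have hslope := hconv.le_slope_of_hasDerivAt (x := 0) (y := 1)
    (by simpa using hx) (by simpa using hy) one_pos hderiv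
  simp [slope_def_field] at hslope
  linarith

/-- Let `f` be convex and differentiable on `K`, `f(0) > 0`, and
`d = −min{⟨f'(0), x⟩ : x ∈ K, ‖x‖ ≤ 1}` positive.  Then `f(x) ≥ f(0) − d‖x‖` on `K`, and
consequently every `x ∈ K` with `f(x) ≤ 0` satisfies `‖x‖ ≥ f(0)/d`; in particular
`ρ_* = min{‖x‖ : x ∈ K, f(x) ≤ 0} ≥ f(0)/d > 0`. -/
theorem norm_min_lower_bound
    {E : Type*} [NormedAddCommGroup E] [InnerProductSpace ℝ E] [FiniteDimensional ℝ E]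
    (nE : E → ℝ)
    (hn0 : ∀ v : E, nE v = 0 ↔ v = 0)
    (hnhom : ∀ (a : ℝ) (v : E), nE (a • v) = |a| * nE v)
    (hntri : ∀ v w : E, nE (v + w) ≤ nE v + nE w)
    (K : Set E) (hKcl : IsClosed K) (hKconv : Convex ℝ K)
    (hKcone : ∀ c : ℝ, 0 ≤ c → ∀ v ∈ K, c • v ∈ K) (hK0 : (0 : E) ∈ K)
    (f : E → ℝ) (f' : E → E)
    (hconv : ConvexOn ℝ K f)
    (hdiff : ∀ v : E, HasGradientAt f (f' v) v)
    (hf0 : 0 < f 0)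
    (u : E) (hu : u ∈ K) (hu1 : nE u ≤ 1)
    (humin : ∀ v ∈ K, nE v ≤ 1 → ⟪f' 0, u⟫ ≤ ⟪f' 0, v⟫)
    (d : ℝ) (hd : d = -⟪f' 0, u⟫) (hdpos : 0 < d) :
    (∀ v ∈ K, f 0 - d * nE v ≤ f v) ∧
    (∀ v ∈ K, f v ≤ 0 → f 0 / d ≤ nE v) ∧
    (∀ ρstar : ℝ, IsLeast {r : ℝ | ∃ v ∈ K, f v ≤ 0 ∧ r = nE v} ρstar →
      f 0 / d ≤ ρstar ∧ 0 < ρstar) := by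
  have hnn : ∀ v, 0 ≤ nE v := fun v => by
    have h0 := (hn0 0).2 rfl
    have hneg := hnhom (-1) v
    have htri := hntri v ((-1 : ℝ) • v)
    simp only [neg_smul, one_smul, add_neg_cancel, abs_neg, abs_one, one_mul] at hneg htri
    linarith
  have hinner : ∀ v ∈ K, -(d * nE v) ≤ ⟪f' 0, v⟫ := by
    intro v hv
    rcases eq_or_ne v 0 with rfl | hv0
    · simp [(hn0 0).2 rfl]
    have hpos : 0 < nE v := (hnn v).lt_of_ne fun h => hv0 ((hn0 v).1 h.symm)
    have hle := humin ((nE v)⁻¹ • v) (hKcone _ (inv_nonneg.2 hpos.le) v hv) (by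
      rw [hnhom, abs_of_pos (inv_pos.2 hpos), inv_mul_cancel₀ hpos.ne'])
    rw [real_inner_smul_right, ← div_eq_inv_mul, le_div_iff₀ hpos] at hle
    rw [hd]
    linarith
  have hlower : ∀ v ∈ K, f 0 - d * nE v ≤ f v := by
    intro v hv
    have hgrad := hconv.add_inner_gradient_le hK0 hv (hdiff 0)
    rw [sub_zero] at hgrad
    linarith [hinner v hv]
  have hnorm : ∀ v ∈ K, f v ≤ 0 → f 0 / d ≤ nE v := by
    intro v hv hfv
    rw [div_le_iff₀ hdpos]
    linarith [hlower v hv]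
  refine ⟨hlower, hnorm, ?_⟩
  rintro _ ⟨⟨v, hv, hfv, rfl⟩, -⟩
  exact ⟨hnorm v hv hfv, (div_pos hf0 hdpos).trans_le (hnorm v hv hfv)⟩
end

section
/- Let L > 0, D > 0, and let (ε_t)_{t≥2} be a sequence of nonnegative reals with ε_2 ≤ (1/2) L D² and ε_{k+1} ≤ ε_k − ε_k²/(8 L D²) for all k ≥ 2. Then ε_t ≤ 8 L D²/(t + 14) for all t ≥ 2. -/
/-- One step of the recurrence `x ↦ x - x² / C` improves the bound `C / s` to `C / (s + 1)`. -/
theorem sub_sq_div_le_div_add_one {C s x : ℝ} (hC : 0 < C) (hs : 1 ≤ s) (hx : 0 ≤ x)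
    (hxs : x ≤ C / s) : x - x ^ 2 / C ≤ C / (s + 1) := by
  have hmul : x * s ≤ C := (le_div_iff₀ (by linarith)).1 hxs
  have hxC : x ≤ C := by nlinarith
  have hprod : x * (C - x) * (s + 1) ≤ C * C := by
    nlinarith [mul_nonneg (sub_nonneg.2 hxC) (sub_nonneg.2 hmul), sq_nonneg x]
  have heq : x - x ^ 2 / C = x * (C - x) / C := by
    field_simp
  rw [heq, div_le_div_iff₀ hC (by linarith)]
  exact hprod

/-- Let `L > 0`, `D > 0`, and let `(ε_t)_{t≥2}` be nonnegative reals with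
`ε_2 ≤ (1/2) L D²` and `ε_{k+1} ≤ ε_k − ε_k²/(8 L D²)` for all `k ≥ 2`.  Then
`ε_t ≤ 8 L D²/(t + 14)` for all `t ≥ 2`. -/
theorem cocndg_recurrence (L D : ℝ) (hL : 0 < L) (hD : 0 < D) (ε : ℕ → ℝ)
    (hpos : ∀ t : ℕ, 2 ≤ t → 0 ≤ ε t)
    (h2 : ε 2 ≤ 1 / 2 * L * D ^ 2)
    (hrec : ∀ k : ℕ, 2 ≤ k → ε (k + 1) ≤ ε k - (ε k) ^ 2 / (8 * L * D ^ 2)) :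
    ∀ t : ℕ, 2 ≤ t → ε t ≤ 8 * L * D ^ 2 / ((t : ℝ) + 14) := by
  have hC : 0 < 8 * L * D ^ 2 := by positivity
  intro t ht
  induction t, ht using Nat.le_induction with
  | base =>
    norm_num
    linarith
  | succ k hk ih =>
    have h := (hrec k hk).trans (sub_sq_div_le_div_add_one hC (by linarith [k.cast_nonneg (α := ℝ)])
      (hpos k hk) ih)
    rwa [Nat.cast_succ, add_right_comm]
end
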